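/- arXiv:0912.1399 — 10 statements merged into one kernel-verified Lean document; each statement's English description precedes it below -/
import Mathlib

section
/- Let R be a commutative Noetherian ring with identity, let P be a finite subset of R, and let I be the ideal generated by P. Let r ≥ 0 be an integer and suppose there exist subsets P_0, P_1, ..., P_r of P such that: (SV1) P = P_0 ∪ P_1 ∪ ... ∪ P_r; (SV2) P_0 has exactly one element; (SV3) for each ℓ with 0 < ℓ ≤ r and every a, a'' ∈ P_ℓ with a ≠ a'', there exist an integer ℓ' with 0 ≤ ℓ' < ℓ and elements a' ∈ P_{ℓ'} and b ∈ I such that a·a'' = a'·b. For each ℓ = 0, 1, ..., r set g_ℓ = Σ_{a ∈ P_ℓ} a. Then the ideal J = (g_0, g_1, ..., g_r) is a reduction of I. -/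
open Polynomial in
/-- The degree one embedding `x ↦ x T` of an ideal into its Rees algebra. -/
noncomputable def Ideal.toReesDegreeOne {R : Type*} [CommRing R] (I : Ideal R) :
    I →ₗ[R] reesAlgebra I where
  toFun x := ⟨monomial 1 (x : R), reesAlgebra.monomial_mem.mpr (by simp)⟩
  map_add' x y := by ext1; simp
  map_smul' c x := by ext1; simp [Polynomial.smul_monomial]

open Polynomial in
theorem Ideal.coeff_mem_mul_pow_of_mem_span_toReesDegreeOne {R : Type*} [CommRing R]
    {I J : Ideal R} {y : reesAlgebra I}
    (hy : y ∈ Ideal.span (I.toReesDegreeOne '' {x : I | (x : R) ∈ J})) (n : ℕ) :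
    (y : R[X]).coeff (n + 1) ∈ J * I ^ n := by
  suffices h : ∀ z : reesAlgebra I, ((z * y : reesAlgebra I) : R[X]).coeff (n + 1) ∈ J * I ^ n by
    simpa using h 1
  induction hy using Submodule.span_induction with
  | mem y hy =>
    obtain ⟨x, hx, rfl⟩ := hy
    intro z
    have hz : (z : R[X]).coeff n ∈ I ^ n := z.2 n
    simpa [Ideal.toReesDegreeOne, coeff_mul_monomial, mul_comm] using Ideal.mul_mem_mul hx hz
  | zero => simp
  | add x y _ _ hx hy =>
    intro z
    simpa [mul_add] using add_mem (hx z) (hy z)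
  | smul a y _ hy =>
    intro z
    simpa [mul_assoc] using hy (z * a)

open Polynomial in
theorem Ideal.exists_mem_span_range_toReesDegreeOne_pow {R : Type*} [CommRing R]
    {I : Ideal R} (n : ℕ) {x : R} (hx : x ∈ I ^ n) :
    ∃ y ∈ Ideal.span (Set.range I.toReesDegreeOne) ^ n, (y : R[X]) = monomial n x := by
  induction n generalizing x with
  | zero => exact ⟨algebraMap R _ x, by simp, rfl⟩
  | succ n ih =>
    rw [pow_succ] at hx
    induction hx using Submodule.mul_induction_on' with
    | mem_mul_mem u hu v hv =>
      obtain ⟨y, hy, hyu⟩ := ih hu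
      refine ⟨y * I.toReesDegreeOne ⟨v, hv⟩, ?_, ?_⟩
      · rw [pow_succ]
        exact Ideal.mul_mem_mul hy (Ideal.subset_span ⟨_, rfl⟩)
      · simp [hyu, Ideal.toReesDegreeOne, monomial_mul_monomial]
    | add u _ v _ hu hv =>
      obtain ⟨y, hy, hyu⟩ := hu
      obtain ⟨z, hz, hzv⟩ := hv
      exact ⟨y + z, add_mem hy hz, by simp [hyu, hzv]⟩

/-- If the degree one part of the Rees algebra of `I` is nilpotent modulo the ideal generated by
`J` in degree one, then `J` is a reduction of `I`. -/
theorem Ideal.exists_pow_succ_eq_mul_pow_of_toReesDegreeOne_mem_radical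
    {R : Type*} [CommRing R] [IsNoetherianRing R] {I J : Ideal R} (hJI : J ≤ I)
    (h : ∀ x : I, I.toReesDegreeOne x ∈
      (Ideal.span (I.toReesDegreeOne '' {x : I | (x : R) ∈ J})).radical) :
    ∃ s : ℕ, 1 ≤ s ∧ I ^ (s + 1) = J * I ^ s := by
  obtain ⟨N, hN⟩ := Ideal.exists_pow_le_of_le_radical_of_fg
    (Ideal.span_le.mpr (Set.range_subset_iff.mpr h)) (IsNoetherian.noetherian _)
  refine ⟨N + 1, by omega, le_antisymm (fun x hx => ?_) ?_⟩
  · obtain ⟨y, hy, hyx⟩ := Ideal.exists_mem_span_range_toReesDegreeOne_pow _ hx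
    have := Ideal.coeff_mem_mul_pow_of_mem_span_toReesDegreeOne
      (hN (Ideal.pow_le_pow_right (by omega : N ≤ N + 1 + 1) hy)) (N + 1)
    simpa [hyx] using this
  · rw [pow_succ' I (N + 1)]
    exact Ideal.mul_mono_left hJI

/-- Schmitt–Vogel type lemma for reductions. -/
theorem schmitt_vogel_for_reductions
    {R : Type*} [CommRing R] [IsNoetherianRing R]
    (P : Finset R) (r : ℕ) (𝓟 : ℕ → Finset R)
    (hsub : ∀ ℓ ≤ r, 𝓟 ℓ ⊆ P)
    (I : Ideal R) (hI : I = Ideal.span (P : Set R))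
    (hSV1 : (P : Set R) = ⋃ ℓ ≤ r, (𝓟 ℓ : Set R))
    (hSV2 : (𝓟 0).card = 1)
    (hSV3 : ∀ ℓ, 0 < ℓ → ℓ ≤ r → ∀ a ∈ 𝓟 ℓ, ∀ a'' ∈ 𝓟 ℓ, a ≠ a'' →
      ∃ ℓ' < ℓ, ∃ a' ∈ 𝓟 ℓ', ∃ b ∈ I, a * a'' = a' * b)
    (g : ℕ → R) (hg : ∀ ℓ ≤ r, g ℓ = ∑ a ∈ 𝓟 ℓ, a)
    (J : Ideal R) (hJ : J = Ideal.span {x | ∃ ℓ ≤ r, x = g ℓ}) :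
    J ≤ I ∧ ∃ s : ℕ, 1 ≤ s ∧ I ^ (s + 1) = J * I ^ s := by
  classical
  have hPI : ∀ ℓ ≤ r, ∀ a ∈ 𝓟 ℓ, a ∈ I := fun ℓ hℓ a ha =>
    hI ▸ Ideal.subset_span (hsub ℓ hℓ ha)
  have hgI : ∀ ℓ ≤ r, g ℓ ∈ I := fun ℓ hℓ => by
    rw [hg ℓ hℓ]
    exact sum_mem (hPI ℓ hℓ)
  have hgJ : ∀ ℓ ≤ r, g ℓ ∈ J := fun ℓ hℓ => hJ ▸ Ideal.subset_span ⟨ℓ, hℓ, rfl⟩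
  have hJI : J ≤ I := by
    rw [hJ, Ideal.span_le]
    rintro _ ⟨ℓ, hℓ, rfl⟩
    exact hgI ℓ hℓ
  refine ⟨hJI, Ideal.exists_pow_succ_eq_mul_pow_of_toReesDegreeOne_mem_radical hJI ?_⟩
  set K := Ideal.span (I.toReesDegreeOne '' {x : I | (x : R) ∈ J})
  have hgK : ∀ ℓ (hℓ : ℓ ≤ r), I.toReesDegreeOne ⟨g ℓ, hgI ℓ hℓ⟩ ∈ K.radical := fun ℓ hℓ =>
    Ideal.le_radical (Ideal.subset_span ⟨_, hgJ ℓ hℓ, rfl⟩)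
  have key : ∀ ℓ ≤ r, ∀ a ∈ 𝓟 ℓ, ∀ ha : a ∈ I, I.toReesDegreeOne ⟨a, ha⟩ ∈ K.radical := by
    intro ℓ
    induction ℓ using Nat.strong_induction_on with
    | _ ℓ ih =>
    intro hℓ a ha haI
    rcases Nat.eq_zero_or_pos ℓ with rfl | hpos
    · obtain ⟨c, hc⟩ := Finset.card_eq_one.mp hSV2
      have hga : g 0 = a := by
        rw [hc, Finset.mem_singleton] at ha
        rw [hg 0 hℓ, hc, Finset.sum_singleton, ha]
      simpa only [hga] using hgK 0 hℓ
    · have hsum : (⟨g ℓ, hgI ℓ hℓ⟩ : I) =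
          ⟨a, haI⟩ + ∑ x ∈ ((𝓟 ℓ).erase a).attach,
            ⟨x, hPI ℓ hℓ x (Finset.mem_of_mem_erase x.2)⟩ := by
        ext1
        simp only [Submodule.coe_add, Submodule.coe_sum]
        rw [Finset.sum_attach _ (fun x => x), hg ℓ hℓ, Finset.add_sum_erase _ (fun x => x) ha]
      have hmul := K.radical.mul_mem_left (I.toReesDegreeOne ⟨a, haI⟩) (hgK ℓ hℓ)
      rw [hsum, map_add, map_sum, mul_add, Finset.mul_sum, Ideal.add_mem_iff_left] at hmul
      · exact Ideal.mem_radical_of_pow_mem (m := 2) (by rwa [pow_two])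
      · refine sum_mem fun x _ => ?_
        obtain ⟨hxa, hx⟩ := Finset.mem_erase.mp x.2
        obtain ⟨ℓ', hℓ', a', ha', b, hb, hab⟩ := hSV3 ℓ hpos hℓ a ha x hx hxa.symm
        have ha'I := hPI ℓ' (by omega) a' ha'
        have : I.toReesDegreeOne ⟨a, haI⟩ * I.toReesDegreeOne ⟨x, hPI ℓ hℓ x hx⟩ =
            I.toReesDegreeOne ⟨a', ha'I⟩ * I.toReesDegreeOne ⟨b, hb⟩ := by
          ext1
          simp [Ideal.toReesDegreeOne, Polynomial.monomial_mul_monomial, hab]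
        rw [this]
        exact K.radical.mul_mem_right _ (ih ℓ' hℓ' (by omega) a' ha' ha'I)
  rintro ⟨x, hx⟩
  have hx' : x ∈ Submodule.span R (P : Set R) := hI.le hx
  induction hx' using Submodule.span_induction with
  | mem x h =>
    rw [hSV1] at h
    simp only [Set.mem_iUnion] at h
    obtain ⟨ℓ, hℓ, h⟩ := h
    exact key ℓ hℓ x h hx
  | zero => exact (map_zero I.toReesDegreeOne).symm ▸ K.radical.zero_mem
  | add u v hu hv hu' hv' =>
    have := K.radical.add_mem (hu' (hI.ge hu)) (hv' (hI.ge hv))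
    rwa [← map_add] at this
  | smul c u hu hu' =>
    have := K.radical.mul_mem_left (algebraMap R _ c) (hu' (hI.ge hu))
    rwa [← Algebra.smul_def, ← map_smul] at this
end

section
/- Let R be a polynomial ring over a field K and let I be an ideal of R generated by squarefree monomials. Suppose there exist finite subsets P_0, P_1, ..., P_r of R satisfying: (SV1) I is generated by P_0 ∪ P_1 ∪ ... ∪ P_r; (SV2) P_0 has exactly one element; (SV3) for each ℓ with 0 < ℓ ≤ r and every a, a'' ∈ P_ℓ with a ≠ a'', there exist an integer ℓ' with 0 ≤ ℓ' < ℓ and elements a' ∈ P_{ℓ'} and b ∈ I such that a·a'' = a'·b; and suppose moreover that r = pd_R(R/I) − 1, where pd_R(R/I) is the projective dimension of R/I over R. Set g_ℓ = Σ_{a ∈ P_ℓ} a for ℓ = 0, ..., r. Then J = (g_0, g_1, ..., g_r) is a reduction of I, and ara(I) = pd_R(R/I) = r + 1. -/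
open CategoryTheory in
/-- The projective dimension of a module: the least length of a projective
resolution (junk value `0` via `sInf` of the empty set if no finite
resolution exists). -/
noncomputable def projDim (R : Type*) [CommRing R] (M : Type*) [AddCommGroup M]
    [Module R M] : ℕ :=
  sInf {n : ℕ | ∃ P : ProjectiveResolution (ModuleCat.of R M),
    ∀ i, n < i → Limits.IsZero (P.complex.X i)}

/-- The arithmetical rank of an ideal: the least number of elements generating
the ideal up to radical. -/
noncomputable def ara {R : Type*} [CommRing R] (I : Ideal R) : ℕ :=
  sInf {r : ℕ | ∃ a : Fin r → R, (Ideal.span (Set.range a)).radical = I.radical}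

section

open CategoryTheory Limits Abelian

namespace CategoryTheory.ProjectiveResolution

variable {C : Type*} [Category* C] [Abelian C]

/-- Splicing a projective resolution of the kernel onto a projective cover. -/
lemma exists_of_shortExact {S : ShortComplex C} (hS : S.ShortExact) [Projective S.X₂]
    (Q : ProjectiveResolution S.X₁) :
    ∃ P : ProjectiveResolution S.X₃, ∀ i, P.complex.X (i + 1) = Q.complex.X i := by
  obtain ⟨ε, hε, hε₀, hεe⟩ : ∃ (ε : Q.complex.X 0 ⟶ S.X₁) (hε : Q.complex.d 1 0 ≫ ε = 0),
      (ShortComplex.mk (Q.complex.d 1 0) ε hε).Exact ∧ Epi ε :=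
    ⟨Q.π.f 0, Q.complex_d_comp_π_f_zero, Q.exact₀, inferInstanceAs (Epi (Q.π.f 0))⟩
  have w : Q.complex.d 1 0 ≫ (ε ≫ S.f) = 0 := by
    rw [← Category.assoc, hε, zero_comp]
  have hw' : (ε ≫ S.f) ≫ S.g = 0 := by
    rw [Category.assoc, S.zero, comp_zero]
  let D := Q.complex.augment (ε ≫ S.f) w
  have hw : D.d 1 0 ≫ S.g = 0 := hw'
  have hEx : ∀ n, D.ExactAt (n + 1) := by
    intro n
    rw [HomologicalComplex.exactAt_iff' _ (n + 2) (n + 1) n (by simp) (by simp)]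
    cases n with
    | zero =>
      let α : ShortComplex.mk (Q.complex.d 1 0) ε hε ⟶
          ShortComplex.mk (Q.complex.d 1 0) (ε ≫ S.f) w :=
        { τ₁ := 𝟙 _
          τ₂ := 𝟙 _
          τ₃ := S.f }
      have : Epi α.τ₁ := inferInstanceAs (Epi (𝟙 _))
      have : IsIso α.τ₂ := inferInstanceAs (IsIso (𝟙 _))
      have : Mono α.τ₃ := hS.mono_f
      exact (ShortComplex.exact_iff_of_epi_of_isIso_of_mono α).1 hε₀
    | succ n => exact Q.exact_succ n
  have hproj : ∀ n, Projective (D.X n) := by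
    intro n
    cases n with
    | zero => exact inferInstanceAs (Projective S.X₂)
    | succ n => exact Q.projective n
  have h0 : (ShortComplex.mk (D.d 1 0) S.g hw).Exact := by
    let α : ShortComplex.mk (ε ≫ S.f) S.g hw' ⟶ S :=
      { τ₁ := ε
        τ₂ := 𝟙 _
        τ₃ := 𝟙 _ }
    have : IsIso α.τ₂ := inferInstanceAs (IsIso (𝟙 _))
    have : Mono α.τ₃ := inferInstanceAs (Mono (𝟙 _))
    exact (ShortComplex.exact_iff_of_epi_of_isIso_of_mono α).2 hS.exact
  have hπ : ((ChainComplex.toSingle₀Equiv D S.X₃).symm ⟨S.g, hw⟩).f 0 = S.g :=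
    ChainComplex.toSingle₀Equiv_symm_apply_f_zero _ _
  refine ⟨{ complex := D, π := (ChainComplex.toSingle₀Equiv _ _).symm ⟨S.g, hw⟩
            projective := hproj, quasiIso := ⟨fun n => ?_⟩ }, fun i => rfl⟩
  cases n with
  | zero =>
    rw [ChainComplex.quasiIsoAt₀_iff, ShortComplex.quasiIso_iff_of_zeros']
    · refine (ShortComplex.exact_and_epi_g_iff_of_iso ?_).2 ⟨h0, hS.epi_g⟩
      exact ShortComplex.isoMk (Iso.refl _) (Iso.refl _) (Iso.refl _)
        ((Category.id_comp _).trans (Category.comp_id _).symm)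
        (by exact (Category.id_comp _).trans ((Category.comp_id _).trans hπ).symm)
    all_goals rfl
  | succ n =>
    rw [quasiIsoAt_iff_exactAt']
    · exact hEx n
    · apply ChainComplex.exactAt_succ_single_obj

/-- An object of projective dimension at most `n` has a projective resolution of length at
most `n`. -/
lemma exists_of_hasProjectiveDimensionLE [EnoughProjectives C] (n : ℕ) (M : C)
    [hM : HasProjectiveDimensionLE M n] :
    ∃ P : ProjectiveResolution M, ∀ i, n < i → IsZero (P.complex.X i) := by
  induction n generalizing M with
  | zero =>
    have : Projective M := (projective_iff_hasProjectiveDimensionLE_zero M).2 hM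
    refine ⟨ProjectiveResolution.self M, fun i hi => ?_⟩
    exact HomologicalComplex.isZero_single_obj_X _ _ _ _ hi.ne'
  | succ n ih =>
    let S := ShortComplex.mk (kernel.ι (Projective.π M)) (Projective.π M) (kernel.condition _)
    have hS : S.ShortExact :=
      { exact := ShortComplex.exact_of_f_is_kernel _ (kernelIsKernel _) }
    have hP : Projective S.X₂ := inferInstanceAs (Projective (Projective.over M))
    have : HasProjectiveDimensionLT S.X₁ (n + 1) :=
      (hS.hasProjectiveDimensionLT_X₃_iff n hP).1 hM
    obtain ⟨Q, hQ⟩ := ih S.X₁ (hM := this)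
    obtain ⟨P, hP⟩ := exists_of_shortExact hS Q
    refine ⟨P, fun i hi => ?_⟩
    obtain ⟨j, rfl⟩ : ∃ j, i = j + 1 := ⟨i - 1, by omega⟩
    rw [hP]
    exact hQ j (by omega)

end CategoryTheory.ProjectiveResolution

/-- Every extension class on `F.obj A` is pushed out from the image under `F` of an extension
class on `A`, if the exact functor `F` preserves projective objects. -/
lemma CategoryTheory.Abelian.Ext.exists_eq_mapExactFunctor_comp
    {C D : Type*} [Category* C] [Category* D] [Abelian C] [Abelian D] [HasExt C] [HasExt D]
    [EnoughProjectives C] (F : C ⥤ D) [F.Additive] [PreservesFiniteLimits F]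
    [PreservesFiniteColimits F] [F.PreservesProjectiveObjects] {n : ℕ} {A : C} {N : D}
    (w : Ext (F.obj A) N n) :
    ∃ (N' : C) (e : Ext A N' n) (θ : F.obj N' ⟶ N),
      (e.mapExactFunctor F).comp (Ext.mk₀ θ) (add_zero n) = w := by
  induction n generalizing A with
  | zero =>
    obtain ⟨θ, rfl⟩ := (Ext.mk₀_bijective _ _).2 w
    exact ⟨A, Ext.mk₀ (𝟙 A), θ, by simp [Ext.mapExactFunctor_mk₀]⟩
  | succ n ih =>
    let S := ShortComplex.mk (kernel.ι (Projective.π A)) (Projective.π A) (kernel.condition _)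
    have hS : S.ShortExact :=
      { exact := ShortComplex.exact_of_f_is_kernel _ (kernelIsKernel _) }
    have hP : Projective (F.obj (Projective.over A)) := inferInstance
    have hw : (Ext.mk₀ (F.map (Projective.π A))).comp w (zero_add _) = 0 :=
      Ext.eq_zero_of_projective (P := F.obj (Projective.over A)) _
    obtain ⟨w', hw'⟩ := Ext.contravariant_sequence_exact₃ (hS.map_of_exact F) _ w hw
      (Nat.add_comm 1 n)
    obtain ⟨N', e, θ, rfl⟩ := ih (A := S.X₁) w'
    refine ⟨N', hS.extClass.comp e (Nat.add_comm 1 n), θ, ?_⟩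
    rw [Ext.mapExactFunctor_comp, Ext.mapExactFunctor_extClass]
    exact (Ext.comp_assoc_of_third_deg_zero _ _ _ _).trans hw'

namespace ModuleCat

universe u

variable {R S : Type u} [CommRing R] [CommRing S] (f : R →+* S)

lemma preservesProjectiveObjects_restrictScalars
    [Projective ((restrictScalars f).obj (of S S))] :
    (restrictScalars.{u} f).PreservesProjectiveObjects := by
  have : (coextendScalars.{u, u, u} f).PreservesEpimorphisms := by
    refine ⟨fun {M N} g hg => ?_⟩
    refine (ModuleCat.epi_iff_surjective _).2 fun h => ?_
    refine ⟨(CoextendScalars.equiv f M).symm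
      (Projective.factorThru (ofHom (CoextendScalars.equiv f N h)) g).hom, ?_⟩
    apply CoextendScalars.ext
    exact congrArg ModuleCat.Hom.hom
      (Projective.factorThru_comp (ofHom (CoextendScalars.equiv f N h)) g)
  exact ⟨fun {X} hX => (restrictCoextendScalarsAdj.{u, u, u} f).map_projective X hX⟩

end ModuleCat

namespace ModuleCat

universe u

variable {R : Type u} [CommRing R]

lemma exists_lsmul_factorization [IsNoetherianRing R] (Q : Type u) [AddCommGroup Q] [Module R Q]
    [Module.Finite R Q] (a : R) (c : ℕ) :
    ∃ (t : ℕ) (s : LinearMap.range (LinearMap.lsmul R Q (a ^ t)) →ₗ[R] Q), c ≤ t ∧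
      ∀ y, a ^ c • s y = (y : Q) := by
  have hmono : Monotone fun n : ℕ => LinearMap.ker (LinearMap.lsmul R Q (a ^ n)) := by
    intro m n hmn x hx
    obtain ⟨d, rfl⟩ := Nat.exists_eq_add_of_le' hmn
    simp only [LinearMap.mem_ker, LinearMap.lsmul_apply] at hx ⊢
    rw [pow_add, mul_smul, hx, smul_zero]
  obtain ⟨d, hd⟩ := monotone_stabilizes_iff_noetherian.2 (inferInstance : IsNoetherian R Q)
    ⟨_, hmono⟩
  have hker : LinearMap.ker (LinearMap.lsmul R Q (a ^ (c + d))) ≤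
      LinearMap.ker (LinearMap.lsmul R Q (a ^ d)) := (hd (c + d) (Nat.le_add_left d c)).ge
  refine ⟨c + d, (Submodule.liftQ _ _ hker) ∘ₗ
    (LinearMap.quotKerEquivRange (LinearMap.lsmul R Q (a ^ (c + d)))).symm.toLinearMap,
    Nat.le_add_right c d, ?_⟩
  rintro ⟨_, x, rfl⟩
  have : (LinearMap.quotKerEquivRange (LinearMap.lsmul R Q (a ^ (c + d)))).symm
      ⟨LinearMap.lsmul R Q (a ^ (c + d)) x, LinearMap.mem_range_self _ x⟩ =
      Submodule.Quotient.mk x := by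
    rw [LinearEquiv.symm_apply_eq]
    rfl
  refine (congrArg (fun z => a ^ c • Submodule.liftQ _ _ hker z) this).trans ?_
  simp [pow_add, mul_smul]

/-- The short complex given by the inclusion of the kernel of a linear map. -/
abbrev kerShortComplex {M P : ModuleCat.{u} R} (p : M ⟶ P) : ShortComplex (ModuleCat.{u} R) :=
  ShortComplex.mk (ofHom (LinearMap.ker p.hom).subtype) p (by ext x; exact x.2)

lemma kerShortComplex_shortExact {M P : ModuleCat.{u} R} (p : M ⟶ P)
    (hp : Function.Surjective p) : (kerShortComplex p).ShortExact where
  exact := (ShortComplex.moduleCat_exact_iff _).2 fun x hx => ⟨⟨x, hx⟩, rfl⟩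
  mono_f := (ModuleCat.mono_iff_injective _).2 Subtype.val_injective
  epi_g := (ModuleCat.epi_iff_surjective _).2 hp

/-- A class on a finite module `M`, in a degree greater than the number of elements of `l`, is
killed by pullback to some finite `l`-power torsion module surjecting onto `M`, if `M` is itself
`l`-power torsion. -/
theorem exists_surjective_mk₀_comp_eq_zero [IsNoetherianRing R] (l : List R) {n : ℕ}
    (hn : l.length < n) (M N : ModuleCat.{u} R) [Module.Finite R M]
    (hM : ∀ a ∈ l, ∃ c : ℕ, ∀ m : M, a ^ c • m = 0) (e : Ext M N n) :
    ∃ (M' : ModuleCat.{u} R) (p : M' ⟶ M), Module.Finite R M' ∧ Function.Surjective p ∧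
      (∀ a ∈ l, ∃ c : ℕ, ∀ m : M', a ^ c • m = 0) ∧
      (Ext.mk₀ p).comp e (zero_add n) = 0 := by
  induction l generalizing n M with
  | nil =>
    obtain ⟨m, p, hp⟩ := Module.Finite.exists_fin' R M
    obtain ⟨n, rfl⟩ : ∃ j, n = j + 1 := ⟨n - 1, by simp at hn; omega⟩
    exact ⟨of R (Fin m → R), ofHom p, inferInstanceAs (Module.Finite R (Fin m → R)), hp, by simp,
      Ext.eq_zero_of_projective _⟩
  | cons a l ih =>
    have hn' : l.length < n := by simp at hn; omega
    obtain ⟨n, rfl⟩ : ∃ j, n = j + 1 := ⟨n - 1, by omega⟩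
    obtain ⟨M', p, hfin, hp, hM', hpe⟩ :=
      ih hn' M (fun b hb => hM b (List.mem_cons_of_mem a hb)) e
    obtain ⟨c, hc⟩ := hM a List.mem_cons_self
    have hS := kerShortComplex_shortExact p hp
    obtain ⟨f, rfl⟩ := Ext.contravariant_sequence_exact₃ hS _ e hpe (Nat.add_comm 1 n)
    let μ : M' ⟶ (kerShortComplex p).X₁ := ofHom <|
      LinearMap.codRestrict _ (LinearMap.lsmul R M' (a ^ c)) fun x => by simp [hc]
    obtain ⟨Q, q, hfinQ, hq, hQ, hqf⟩ := ih (by simp at hn; omega) M' hM'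
      ((Ext.mk₀ μ).comp f (zero_add n))
    obtain ⟨t, s, hct, hs⟩ := exists_lsmul_factorization Q a c
    let T : Submodule R Q := LinearMap.range (LinearMap.lsmul R Q (a ^ t))
    let π : Q ⟶ of R (Q ⧸ T) := ofHom T.mkQ
    have hπ : Function.Surjective π := T.mkQ_surjective
    have hkerπ : LinearMap.ker π.hom = T := T.ker_mkQ
    have hT : T ≤ LinearMap.ker (q ≫ p).hom := by
      rintro _ ⟨x, rfl⟩
      obtain ⟨d, rfl⟩ := Nat.exists_eq_add_of_le hct
      refine ((q ≫ p).hom.map_smul _ x).trans ?_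
      rw [pow_add, mul_smul, hc]
    let ρ : of R (Q ⧸ T) ⟶ M := ofHom (T.liftQ (q ≫ p).hom hT)
    have hπρ : π ≫ ρ = q ≫ p := by
      ext x
      rfl
    let s' : (kerShortComplex π).X₁ ⟶ Q :=
      ofHom (s ∘ₗ (LinearEquiv.ofEq _ _ hkerπ).toLinearMap)
    let α : kerShortComplex π ⟶ kerShortComplex p :=
      { τ₁ := s' ≫ q ≫ μ
        τ₂ := q
        τ₃ := ρ
        comm₁₂ := by
          ext x
          have := hs ⟨x, hkerπ.le x.2⟩
          exact (map_smul q.hom _ _).symm.trans (congrArg q.hom this)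
        comm₂₃ := hπρ.symm }
    have hsurj : Function.Surjective ρ := by
      have : Function.Surjective (ρ.hom ∘ π.hom) := hp.comp hq
      exact Function.Surjective.of_comp this
    refine ⟨of R (Q ⧸ T), ρ, inferInstanceAs (Module.Finite R (Q ⧸ T)), hsurj, ?_, ?_⟩
    · intro b hb
      rcases List.mem_cons.1 hb with rfl | hb
      · refine ⟨t, fun m => ?_⟩
        obtain ⟨x, rfl⟩ := T.mkQ_surjective m
        exact (map_smul T.mkQ _ _).symm.trans
          ((Submodule.Quotient.mk_eq_zero T).2 (LinearMap.mem_range_self _ x))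
      · obtain ⟨d, hd⟩ := hQ b hb
        refine ⟨d, fun m => ?_⟩
        obtain ⟨x, rfl⟩ := T.mkQ_surjective m
        rw [← map_smul, hd, map_zero]
    · have hnat := ShortComplex.ShortExact.extClass_naturality
        (kerShortComplex_shortExact π hπ) hS α
      rw [← Ext.comp_assoc (a₁₂ := 1) (a₂₃ := n + 1) _ _ _ (by lia) (by lia) (by lia), ← hnat,
        Ext.comp_assoc (a₁₂ := 1) (a₂₃ := n) _ _ _ (by lia) (by lia) (by lia)]
      have h1 : (Ext.mk₀ α.τ₁).comp f (zero_add n) = 0 := by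
        change (Ext.mk₀ (s' ≫ q ≫ μ)).comp f (zero_add n) = 0
        rw [← Ext.mk₀_comp_mk₀_assoc, ← Ext.mk₀_comp_mk₀_assoc, hqf, Ext.comp_zero]
      rw [h1, Ext.comp_zero]

end ModuleCat

/-- There is a class in degree `n` of which every class of `A` in degree `n` is a pushout. -/
lemma CategoryTheory.Abelian.Ext.exists_universal
    {C : Type*} [Category* C] [Abelian C] [HasExt C] [EnoughProjectives C] (A : C) (n : ℕ) :
    ∃ (Z : C) (u : Ext A Z n), ∀ (N : C) (e : Ext A N n), ∃ θ : Z ⟶ N,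
      u.comp (Ext.mk₀ θ) (add_zero n) = e := by
  induction n generalizing A with
  | zero =>
    refine ⟨A, Ext.mk₀ (𝟙 A), fun N e => ?_⟩
    obtain ⟨θ, rfl⟩ := (Ext.mk₀_bijective _ _).2 e
    exact ⟨θ, by simp⟩
  | succ n ih =>
    let S := ShortComplex.mk (kernel.ι (Projective.π A)) (Projective.π A) (kernel.condition _)
    have hS : S.ShortExact :=
      { exact := ShortComplex.exact_of_f_is_kernel _ (kernelIsKernel _) }
    obtain ⟨Z, u, hu⟩ := ih S.X₁
    refine ⟨Z, hS.extClass.comp u (Nat.add_comm 1 n), fun N e => ?_⟩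
    obtain ⟨e', he'⟩ := Ext.contravariant_sequence_exact₃ hS _ e
      (Ext.eq_zero_of_projective (P := Projective.over A) _) (Nat.add_comm 1 n)
    obtain ⟨θ, rfl⟩ := hu N e'
    exact ⟨θ, (Ext.comp_assoc_of_third_deg_zero _ _ _ _).trans he'⟩

namespace ModuleCat

universe u

variable {R : Type u} [CommRing R]

/-- If `R` has suitable split endomorphisms sending `I` into high powers of `I`, then the higher
`Ext` modules of `R ⧸ I` vanish beyond the number of elements cutting out `I` up to radical. -/
lemma ext_quotient_eq_zero [IsNoetherianRing R] (I : Ideal R) (l : List R)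
    (hl : (Ideal.span {a | a ∈ l}).radical = I.radical)
    (H : ∀ s : ℕ, ∃ (φ : R →+* R) (ψ : R →+ R),
      Projective ((restrictScalars.{u} φ).obj (of R R)) ∧ (∀ x ∈ I, φ x ∈ I ^ s) ∧
      (∀ x ∈ I, φ x ∈ I) ∧
      (∀ r x, ψ (φ r * x) = r * ψ x) ∧ ψ 1 = 1 ∧ ∀ x ∈ I, ψ x ∈ I)
    {n : ℕ} (hn : l.length < n) (N : ModuleCat.{u} R) (e : Ext (of R (R ⧸ I)) N n) : e = 0 := by
  obtain ⟨Z, u, hu⟩ := Ext.exists_universal (of R (R ⧸ I)) n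
  have hM : ∀ a ∈ l, ∃ c : ℕ, ∀ m : R ⧸ I, a ^ c • m = 0 := by
    intro a ha
    have : a ∈ I.radical := hl.le (Ideal.le_radical (Ideal.subset_span ha))
    obtain ⟨c, hc⟩ := this
    refine ⟨c, fun m => ?_⟩
    obtain ⟨x, rfl⟩ := Ideal.Quotient.mk_surjective m
    exact Ideal.Quotient.eq_zero_iff_mem.2 (I.mul_mem_right x hc)
  obtain ⟨M', p, hfin, hp, hM', hpu⟩ :=
    exists_surjective_mk₀_comp_eq_zero l hn (of R (R ⧸ I)) Z hM u
  have hpe : ∀ (N : ModuleCat.{u} R) (e : Ext (of R (R ⧸ I)) N n),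
      (Ext.mk₀ p).comp e (zero_add n) = 0 := by
    intro N e
    obtain ⟨θ, rfl⟩ := hu N e
    rw [← Ext.comp_assoc_of_third_deg_zero, hpu, Ext.zero_comp]
  obtain ⟨s, hs⟩ : ∃ s, I ^ s ≤ Module.annihilator R M' := by
    refine Ideal.exists_pow_le_of_le_radical_of_fg ?_ (IsNoetherian.noetherian I)
    refine Ideal.le_radical.trans (hl.ge.trans ?_)
    rw [Ideal.radical_le_radical_iff, Ideal.span_le]
    intro a ha
    obtain ⟨c, hc⟩ := hM' a ha
    exact ⟨c, Module.mem_annihilator.2 hc⟩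
  obtain ⟨φ, ψ, hproj, hφs, hφI, hψφ, hψ1, hψI⟩ := H s
  have := preservesProjectiveObjects_restrictScalars φ
  obtain ⟨m', hm'⟩ := hp (1 : R ⧸ I)
  let F := restrictScalars.{u} φ
  let κ : of R (R ⧸ I) ⟶ F.obj M' := ofHom (Y := F.obj M') <| Submodule.liftQ I
    { toFun := fun r => (φ r • m' : M')
      map_add' := fun x y => by
        rw [map_add]
        exact add_smul _ _ m'
      map_smul' := fun x y => by
        change φ (x * y) • m' = φ x • φ y • m'
        rw [map_mul, mul_smul] }
    (fun x hx => Module.mem_annihilator.1 (hs (hφs x hx)) m')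
  let ψ' : F.obj (of R (R ⧸ I)) ⟶ of R (R ⧸ I) := ofHom (X := F.obj (of R (R ⧸ I)))
    { toFun := QuotientAddGroup.map I.toAddSubgroup I.toAddSubgroup ψ hψI
      map_add' := map_add _
      map_smul' := by
        intro r x
        obtain ⟨x, rfl⟩ := Ideal.Quotient.mk_surjective x
        exact congrArg (Ideal.Quotient.mk I) (hψφ r x) }
  have hκ : κ ≫ F.map p ≫ ψ' = 𝟙 _ := by
    refine ModuleCat.hom_ext (LinearMap.ext fun x => ?_)
    obtain ⟨x, rfl⟩ := Ideal.Quotient.mk_surjective x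
    have h1 : p (φ x • m') = Ideal.Quotient.mk I (φ x) := by
      rw [map_smul, hm']
      exact congrArg (Ideal.Quotient.mk I) (mul_one _)
    have h2 : ψ (φ x) = x := by simpa [hψ1] using hψφ x 1
    refine (congrArg ψ'.hom h1).trans ?_
    exact congrArg (Ideal.Quotient.mk I) h2
  obtain ⟨N', e', θ, hw⟩ := Ext.exists_eq_mapExactFunctor_comp F
    ((Ext.mk₀ ψ').comp e (zero_add n))
  have h0 : (Ext.mk₀ (F.map p)).comp (e'.mapExactFunctor F) (zero_add n) = 0 := by
    rw [← Ext.mapExactFunctor_mk₀, ← Ext.mapExactFunctor_comp, hpe, Ext.mapExactFunctor_zero]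
  calc e = (Ext.mk₀ (κ ≫ F.map p ≫ ψ')).comp e (zero_add n) := by rw [hκ, Ext.mk₀_id_comp]
    _ = (Ext.mk₀ κ).comp ((Ext.mk₀ (F.map p)).comp ((Ext.mk₀ ψ').comp e (zero_add n))
          (zero_add n)) (zero_add n) := by
      rw [Ext.mk₀_comp_mk₀_assoc, Ext.mk₀_comp_mk₀_assoc]
      simp
    _ = 0 := by
      rw [← hw, ← Ext.comp_assoc_of_third_deg_zero, h0, Ext.zero_comp, Ext.comp_zero]

end ModuleCat

end

namespace MvPolynomial

variable {σ K : Type*} [Field K]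

open Classical in
/-- The `K`-linear map sending a monomial `x ^ (T • m + b)`, with `b < T` coordinatewise, to
`x ^ m`, and killing the monomials that are not of this form. -/
noncomputable def expandCoord (T : ℕ) (b : σ → ℕ) :
    MvPolynomial σ K →ₗ[K] MvPolynomial σ K :=
  (basisMonomials σ K).constr K fun d =>
    if ∀ j, d j % T = b j then monomial (d.mapRange (· / T) (Nat.zero_div T)) 1 else 0

open Classical in
lemma expandCoord_monomial (T : ℕ) (b : σ → ℕ) (d : σ →₀ ℕ) (c : K) :
    expandCoord T b (monomial d c) =
      if ∀ j, d j % T = b j then monomial (d.mapRange (· / T) (Nat.zero_div T)) c else 0 := by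
  have h : (monomial d c : MvPolynomial σ K) = c • basisMonomials σ K d := by
    simp [smul_monomial]
  rw [h, map_smul, expandCoord, Module.Basis.constr_basis]
  split_ifs <;> simp [smul_monomial]

lemma expandCoord_expand_mul {T : ℕ} (hT : 0 < T) (b : σ → ℕ) (r p : MvPolynomial σ K) :
    expandCoord T b (expand T r * p) = r * expandCoord T b p := by
  classical
  induction r using MvPolynomial.induction_on' with
  | add r r' hr hr' => rw [map_add, add_mul, map_add, hr, hr', add_mul]
  | monomial e a =>
    induction p using MvPolynomial.induction_on' with
    | add p p' hp hp' => rw [mul_add, map_add, hp, hp', map_add, mul_add]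
    | monomial d c =>
      rw [expand_monomial, monomial_mul, expandCoord_monomial, expandCoord_monomial]
      have h1 : (∀ j, (T • e + d) j % T = b j) ↔ ∀ j, d j % T = b j := by
        simp
      have h2 : (T • e + d).mapRange (· / T) (Nat.zero_div T) =
          e + d.mapRange (· / T) (Nat.zero_div T) := by
        ext j
        simp [Nat.mul_add_div hT]
      simp only [h1, h2]
      split_ifs
      · rw [monomial_mul]
      · rw [mul_zero]

lemma expandCoord_zero_one (T : ℕ) :
    expandCoord T 0 (1 : MvPolynomial σ K) = 1 := by
  have : (1 : MvPolynomial σ K) = monomial 0 1 := rfl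
  rw [this, expandCoord_monomial, if_pos (by simp)]
  congr
  ext j
  simp

open Classical in
lemma sum_expand_expandCoord_mul [Fintype σ] {T : ℕ} (hT : 0 < T) (p : MvPolynomial σ K) :
    ∑ b : σ → Fin T, expand T (expandCoord T (fun j => b j) p) *
      monomial (Finsupp.equivFunOnFinite.symm fun j => (b j : ℕ)) 1 = p := by
  induction p using MvPolynomial.induction_on' with
  | add p q hp hq =>
    simp only [map_add, add_mul, Finset.sum_add_distrib]
    rw [hp, hq]
  | monomial d c =>
    rw [Finset.sum_eq_single fun j => ⟨d j % T, Nat.mod_lt _ hT⟩]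
    · rw [expandCoord_monomial, if_pos fun j => rfl, expand_monomial, monomial_mul, mul_one]
      congr
      ext j
      simp [Nat.div_add_mod]
    · intro b _ hb
      rw [expandCoord_monomial, if_neg, map_zero, zero_mul]
      exact fun h => hb (_root_.funext fun j => Fin.ext (h j).symm)
    · simp

lemma expandCoord_zero_mem {T : ℕ} (hT : 0 < T) {S : Set (Finset σ)} {p : MvPolynomial σ K}
    (hp : p ∈ Ideal.span ((fun t => ∏ j ∈ t, (X j : MvPolynomial σ K)) '' S)) :
    expandCoord T 0 p ∈ Ideal.span ((fun t => ∏ j ∈ t, (X j : MvPolynomial σ K)) '' S) := by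
  classical
  suffices h : ∀ r, expandCoord T 0 (r * p) ∈
      Ideal.span ((fun t => ∏ j ∈ t, (X j : MvPolynomial σ K)) '' S) by
    simpa using h 1
  induction hp using Submodule.span_induction with
  | zero => simp
  | add x y _ _ hx hy =>
    intro r
    rw [mul_add, map_add]
    exact add_mem (hx r) (hy r)
  | smul r x _ hx =>
    intro r'
    rw [smul_eq_mul, ← mul_assoc]
    exact hx _
  | mem x hx =>
    obtain ⟨t, ht, rfl⟩ := hx
    intro r
    induction r using MvPolynomial.induction_on' with
    | add r r' hr hr' =>
      rw [add_mul, map_add]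
      exact add_mem hr hr'
    | monomial d c =>
      have hX : ∏ j ∈ t, (X j : MvPolynomial σ K) =
          monomial (∑ j ∈ t, Finsupp.single j 1) 1 := (monomial_sum_one t _).symm
      simp only [hX]
      rw [monomial_mul, expandCoord_monomial]
      split_ifs with h
      · refine Ideal.mem_of_dvd _ ?_ (Ideal.subset_span ⟨t, ht, rfl⟩)
        simp only [hX]
        refine monomial_dvd_monomial.2 ⟨Or.inr fun i => ?_, one_dvd _⟩
        have hi := h i
        simp only [Finsupp.mapRange_apply, Finsupp.coe_add, Pi.add_apply, Finsupp.finsetSum_apply,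
          Pi.zero_apply, Finsupp.single_apply, Finset.sum_ite_eq'] at hi ⊢
        split_ifs at hi ⊢ with hit
        · exact (Nat.one_le_div_iff hT).2 (Nat.le_of_dvd (by omega) (Nat.dvd_of_mod_eq_zero hi))
        · exact Nat.zero_le _
      · exact zero_mem _

lemma expand_mem_pow (T s : ℕ) (hs : s ≤ T) {S : Set (Finset σ)} {p : MvPolynomial σ K}
    (hp : p ∈ Ideal.span ((fun t => ∏ j ∈ t, (X j : MvPolynomial σ K)) '' S)) :
    expand T p ∈ Ideal.span ((fun t => ∏ j ∈ t, (X j : MvPolynomial σ K)) '' S) ^ s := by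
  have h : Ideal.span ((fun t => ∏ j ∈ t, (X j : MvPolynomial σ K)) '' S) ≤
      (Ideal.span ((fun t => ∏ j ∈ t, (X j : MvPolynomial σ K)) '' S) ^ s).comap
        (expand T : MvPolynomial σ K →ₐ[K] MvPolynomial σ K) := by
    refine Ideal.span_le.2 ?_
    rintro _ ⟨t, ht, rfl⟩
    simp only [SetLike.mem_coe, Ideal.mem_comap, map_prod, expand_X, Finset.prod_pow]
    exact Ideal.pow_le_pow_right hs
      (Ideal.pow_mem_pow (Ideal.subset_span (Set.mem_image_of_mem _ ht)) T)
  exact h hp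

open Classical CategoryTheory in
lemma projective_restrictScalars_expand [Fintype σ] {T : ℕ} (hT : 0 < T) :
    Projective ((ModuleCat.restrictScalars
      (expand T : MvPolynomial σ K →ₐ[K] MvPolynomial σ K).toRingHom).obj
        (ModuleCat.of (MvPolynomial σ K) (MvPolynomial σ K))) := by
  let φ := (expand T : MvPolynomial σ K →ₐ[K] MvPolynomial σ K).toRingHom
  let Q := (ModuleCat.restrictScalars φ).obj
    (ModuleCat.of (MvPolynomial σ K) (MvPolynomial σ K))
  let i : Q →ₗ[MvPolynomial σ K] ((σ → Fin T) → MvPolynomial σ K) :=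
    { toFun := fun p b => expandCoord T (fun j => b j) p
      map_add' := fun p q => _root_.funext fun b => map_add _ _ _
      map_smul' := fun r p => _root_.funext fun b => expandCoord_expand_mul hT (fun j => b j) r p }
  let s : ((σ → Fin T) → MvPolynomial σ K) →ₗ[MvPolynomial σ K] Q :=
    { toFun := fun v => (∑ b : σ → Fin T, expand T (v b) *
        monomial (Finsupp.equivFunOnFinite.symm fun j => (b j : ℕ)) 1 : MvPolynomial σ K)
      map_add' := fun v w => by
        simp only [Pi.add_apply, map_add, add_mul, Finset.sum_add_distrib]
        rfl
      map_smul' := fun r v => by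
        simp only [Pi.smul_apply, smul_eq_mul, map_mul, mul_assoc, ← Finset.mul_sum]
        rfl }
  have h : Module.Projective (MvPolynomial σ K) Q :=
    .of_split i s (LinearMap.ext fun p => sum_expand_expandCoord_mul hT p)
  exact (IsProjective.iff_projective (R := MvPolynomial σ K) Q).1 h

end MvPolynomial

namespace Ideal

variable {R : Type*} [CommRing R]

lemma exists_sup_pow_le {I J A B : Ideal R} (hA : A ≤ I) (hB : B ≤ I)
    (h : ∃ N, A ^ (N + 1) ≤ J * I ^ N) (h' : ∃ N, B ^ (N + 1) ≤ J * I ^ N) :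
    ∃ N, (A ⊔ B) ^ (N + 1) ≤ J * I ^ N := by
  obtain ⟨m, hm⟩ := h
  obtain ⟨n, hn⟩ := h'
  refine ⟨m + n + 1, ?_⟩
  rw [← Ideal.add_eq_sup, add_pow, Ideal.sum_eq_sup]
  refine Finset.sup_le fun i hi => ?_
  refine Ideal.mul_le_left.trans ?_
  rw [Finset.mem_range] at hi
  rcases Nat.lt_or_ge m i with hmi | hmi
  · obtain ⟨d, rfl⟩ := Nat.exists_eq_add_of_lt hmi
    calc A ^ (m + d + 1) * B ^ (m + n + 1 + 1 - (m + d + 1))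
        = A ^ (m + 1) * (A ^ d * B ^ (m + n + 1 + 1 - (m + d + 1))) := by ring
      _ ≤ J * I ^ m * (I ^ d * I ^ (m + n + 1 + 1 - (m + d + 1))) := by gcongr
      _ = J * I ^ (m + n + 1) := by
        rw [mul_assoc, ← pow_add, ← pow_add]
        congr 2
        omega
  · obtain ⟨d, hd⟩ := Nat.exists_eq_add_of_le (show n + 1 ≤ m + n + 1 + 1 - i by omega)
    rw [hd]
    calc A ^ i * B ^ (n + 1 + d)
        = B ^ (n + 1) * (A ^ i * B ^ d) := by ring
      _ ≤ J * I ^ n * (I ^ i * I ^ d) := by gcongr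
      _ = J * I ^ (m + n + 1) := by
        rw [mul_assoc, ← pow_add, ← pow_add]
        congr 2
        omega

lemma exists_pow_le_of_sq_le {I J A B : Ideal R} (hJ : J ≤ I) (hB : B ≤ I)
    (h : ∃ N, B ^ (N + 1) ≤ J * I ^ N) (hAB : A ^ 2 ≤ (J ⊔ B) * I) :
    ∃ N, A ^ (N + 1) ≤ J * I ^ N := by
  obtain ⟨N, hN⟩ := exists_sup_pow_le hJ hB ⟨0, by simp⟩ h
  refine ⟨2 * N + 1, ?_⟩
  calc A ^ (2 * N + 1 + 1) = (A ^ 2) ^ (N + 1) := by ring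
    _ ≤ ((J ⊔ B) * I) ^ (N + 1) := by gcongr
    _ = (J ⊔ B) ^ (N + 1) * I ^ (N + 1) := mul_pow _ _ _
    _ ≤ J * I ^ N * I ^ (N + 1) := by gcongr
    _ = J * I ^ (2 * N + 1) := by ring

lemma exists_span_pow_le (I J : Ideal R) (s : Finset R) (hs : ∀ a ∈ s, a ∈ I)
    (h : ∀ a ∈ s, ∃ N, span {a} ^ (N + 1) ≤ J * I ^ N) :
    ∃ N, span (s : Set R) ^ (N + 1) ≤ J * I ^ N := by
  classical
  induction s using Finset.induction_on with
  | empty => exact ⟨0, by simp⟩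
  | insert a s ha ih =>
    rw [Finset.coe_insert, Ideal.span_insert]
    refine exists_sup_pow_le ((span_singleton_le_iff_mem I).2 (hs a (by simp)))
      (span_le.2 fun x hx => hs x (by simp [Finset.mem_coe.1 hx])) (h a (by simp)) ?_
    exact ih (fun x hx => hs x (by simp [hx])) fun x hx => h x (by simp [hx])

/-- The Schmitt–Vogel sums generate a reduction. -/
theorem exists_pow_succ_eq_mul_pow_of_schmittVogel (I J : Ideal R) (r : ℕ) (P : ℕ → Finset R)
    (hI : I = span (⋃ ℓ ≤ r, (P ℓ : Set R))) (hP₀ : (P 0).card = 1)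
    (hP : ∀ ℓ, 0 < ℓ → ℓ ≤ r → ∀ a ∈ P ℓ, ∀ a'' ∈ P ℓ, a ≠ a'' →
      ∃ ℓ' < ℓ, ∃ a' ∈ P ℓ', ∃ b ∈ I, a * a'' = a' * b)
    (hJ : J = span {x | ∃ ℓ ≤ r, x = ∑ a ∈ P ℓ, a}) :
    J ≤ I ∧ ∃ s : ℕ, 1 ≤ s ∧ I ^ (s + 1) = J * I ^ s := by
  classical
  have hPI : ∀ ℓ ≤ r, ∀ a ∈ P ℓ, a ∈ I := fun ℓ hℓ a ha =>
    hI ▸ subset_span (Set.mem_iUnion₂.2 ⟨ℓ, hℓ, ha⟩)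
  have hsum : ∀ ℓ ≤ r, ∑ a ∈ P ℓ, a ∈ J := fun ℓ hℓ => hJ ▸ subset_span ⟨ℓ, hℓ, rfl⟩
  have hJI : J ≤ I := by
    rw [hJ, span_le]
    rintro _ ⟨ℓ, hℓ, rfl⟩
    exact _root_.sum_mem fun a ha => hPI ℓ hℓ a ha
  have key : ∀ ℓ, ℓ ≤ r → ∀ a ∈ P ℓ, ∃ N, span {a} ^ (N + 1) ≤ J * I ^ N := by
    intro ℓ
    induction ℓ using Nat.strong_induction_on with
    | _ ℓ ih =>
      intro hℓ a ha
      rcases Nat.eq_zero_or_pos ℓ with rfl | hpos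
      · obtain ⟨b, hb⟩ := Finset.card_eq_one.1 hP₀
        refine ⟨0, ?_⟩
        have := hsum 0 hℓ
        rw [hb, Finset.mem_singleton] at ha
        rw [hb, Finset.sum_singleton] at this
        simpa [ha, span_singleton_le_iff_mem] using this
      · let s := (Finset.range ℓ).biUnion P
        have hsI : ∀ x ∈ s, x ∈ I := fun x hx => by
          obtain ⟨k, hk, hxk⟩ := Finset.mem_biUnion.1 hx
          exact hPI k ((Finset.mem_range.1 hk).le.trans hℓ) x hxk
        refine exists_pow_le_of_sq_le hJI (span_le.2 hsI) (exists_span_pow_le I J s hsI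
          fun x hx => ?_) ?_
        · obtain ⟨k, hk, hxk⟩ := Finset.mem_biUnion.1 hx
          have hk := Finset.mem_range.1 hk
          exact ih k hk (hk.le.trans hℓ) x hxk
        · rw [span_singleton_pow, span_singleton_le_iff_mem]
          have h : a ^ 2 = (∑ x ∈ P ℓ, x) * a - ∑ x ∈ (P ℓ).erase a, a * x := by
            rw [← Finset.add_sum_erase _ _ ha, ← Finset.mul_sum]
            ring
          rw [h]
          refine sub_mem (mul_mem_mul (mem_sup_left (hsum ℓ hℓ)) (hPI ℓ hℓ a ha))
            (_root_.sum_mem fun x hx => ?_)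
          obtain ⟨hne, hx⟩ := Finset.mem_erase.1 hx
          obtain ⟨k, hk, a', ha', b, hb, hab⟩ := hP ℓ hpos hℓ a ha x hx hne.symm
          rw [hab]
          refine mul_mem_mul (mem_sup_right (subset_span ?_)) hb
          exact Finset.mem_biUnion.2 ⟨k, Finset.mem_range.2 hk, ha'⟩
  refine ⟨hJI, ?_⟩
  have hI' : I = span (((Finset.range (r + 1)).biUnion P : Finset R) : Set R) := by
    rw [hI]
    congr 1
    ext x
    simp
  obtain ⟨N, hN⟩ := exists_span_pow_le I J ((Finset.range (r + 1)).biUnion P)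
    (fun x hx => hI'.ge (subset_span hx)) fun x hx => by
      obtain ⟨k, hk, hxk⟩ := Finset.mem_biUnion.1 hx
      exact key k (Nat.lt_succ_iff.1 (Finset.mem_range.1 hk)) x hxk
  rw [← hI'] at hN
  refine ⟨N + 1, Nat.le_add_left 1 N, le_antisymm ?_ ?_⟩
  · calc I ^ (N + 1 + 1) = I ^ (N + 1) * I := pow_succ _ _
      _ ≤ J * I ^ N * I := by gcongr
      _ = J * I ^ (N + 1) := by ring
  · calc J * I ^ (N + 1) ≤ I * I ^ (N + 1) := by gcongr
      _ = I ^ (N + 1 + 1) := by ring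

end Ideal

section

open MvPolynomial CategoryTheory

/-- The projective dimension of a squarefree monomial quotient is at most the number of elements
cutting out the ideal up to radical. -/
lemma projDim_le_of_radical_eq {K : Type*} [Field K] {σ : Type*} [Fintype σ]
    (I : Ideal (MvPolynomial σ K))
    (hsf : ∃ S : Set (Finset σ), I = Ideal.span
      ((fun t => ∏ j ∈ t, (X j : MvPolynomial σ K)) '' S))
    {k : ℕ} (a : Fin k → MvPolynomial σ K)
    (ha : (Ideal.span (Set.range a)).radical = I.radical) :
    projDim (MvPolynomial σ K) (MvPolynomial σ K ⧸ I) ≤ k := by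
  obtain ⟨S, rfl⟩ := hsf
  have : HasProjectiveDimensionLE (ModuleCat.of (MvPolynomial σ K) (MvPolynomial σ K ⧸
      Ideal.span ((fun t => ∏ j ∈ t, (X j : MvPolynomial σ K)) '' S))) k := by
    refine (hasProjectiveDimensionLT_iff _ _).2 fun i hi N e => ?_
    refine ModuleCat.ext_quotient_eq_zero _ (List.ofFn a) ?_ (fun s => ?_) (by simpa using hi) N e
    · rw [← ha]
      congr 2
      ext x
      simp [List.mem_ofFn]
    · refine ⟨(expand (s + 1) : MvPolynomial σ K →ₐ[K] MvPolynomial σ K).toRingHom,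
        (expandCoord (s + 1) 0).toAddMonoidHom,
        projective_restrictScalars_expand s.succ_pos,
        fun x hx => expand_mem_pow _ _ s.le_succ hx, fun x hx => ?_,
        expandCoord_expand_mul s.succ_pos 0, expandCoord_zero_one _,
        fun x hx => expandCoord_zero_mem s.succ_pos hx⟩
      have := expand_mem_pow (s + 1) 1 (Nat.le_add_left 1 s) hx
      rwa [pow_one] at this
  obtain ⟨P, hP⟩ := ProjectiveResolution.exists_of_hasProjectiveDimensionLE k _ (hM := this)
  exact Nat.sInf_le ⟨P, hP⟩

end

open MvPolynomial in
/-- Corollary: for a squarefree monomial ideal with Schmitt–Vogel data of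
length `pd(R/I) - 1`, the Schmitt–Vogel sums give a reduction of `I`, and
`ara I = pd(R/I) = r + 1`. -/
theorem squarefree_SV_reduction_and_ara
    {K : Type*} [Field K] {σ : Type*} [Fintype σ]
    (I : Ideal (MvPolynomial σ K))
    (hsf : ∃ S : Set (Finset σ), I = Ideal.span
      ((fun t => ∏ j ∈ t, (X j : MvPolynomial σ K)) '' S))
    (r : ℕ) (𝓟 : ℕ → Finset (MvPolynomial σ K))
    (hSV1 : I = Ideal.span (⋃ ℓ ≤ r, (𝓟 ℓ : Set (MvPolynomial σ K))))
    (hSV2 : (𝓟 0).card = 1)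
    (hSV3 : ∀ ℓ, 0 < ℓ → ℓ ≤ r → ∀ a ∈ 𝓟 ℓ, ∀ a'' ∈ 𝓟 ℓ, a ≠ a'' →
      ∃ ℓ' < ℓ, ∃ a' ∈ 𝓟 ℓ', ∃ b ∈ I, a * a'' = a' * b)
    (hr : (r : ℤ) = (projDim (MvPolynomial σ K) (MvPolynomial σ K ⧸ I) : ℤ) - 1)
    (g : ℕ → MvPolynomial σ K) (hg : ∀ ℓ ≤ r, g ℓ = ∑ a ∈ 𝓟 ℓ, a)
    (J : Ideal (MvPolynomial σ K))
    (hJ : J = Ideal.span {x | ∃ ℓ ≤ r, x = g ℓ}) :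
    (J ≤ I ∧ ∃ s : ℕ, 1 ≤ s ∧ I ^ (s + 1) = J * I ^ s) ∧
      ara I = projDim (MvPolynomial σ K) (MvPolynomial σ K ⧸ I) ∧
      projDim (MvPolynomial σ K) (MvPolynomial σ K ⧸ I) = r + 1 := by
  have hJ' : J = Ideal.span {x | ∃ ℓ ≤ r, x = ∑ a ∈ 𝓟 ℓ, a} := by
    rw [hJ]
    congr 1
    ext x
    exact exists_congr fun ℓ => and_congr_right fun hℓ => by rw [hg ℓ hℓ]
  obtain ⟨hJI, s, hs, hred⟩ :=
    Ideal.exists_pow_succ_eq_mul_pow_of_schmittVogel I J r 𝓟 hSV1 hSV2 hSV3 hJ'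
  have hspan : Ideal.span (Set.range fun i : Fin (r + 1) => g i) = J := by
    rw [hJ]
    congr 1
    ext x
    constructor
    · rintro ⟨i, rfl⟩
      exact ⟨i, Nat.lt_succ_iff.1 i.2, rfl⟩
    · rintro ⟨ℓ, hℓ, rfl⟩
      exact ⟨⟨ℓ, Nat.lt_succ_iff.2 hℓ⟩, rfl⟩
  have hrad : J.radical = I.radical := by
    refine le_antisymm (Ideal.radical_mono hJI) ?_
    rw [← Ideal.radical_pow I s.succ_ne_zero]
    exact Ideal.radical_mono (hred.le.trans Ideal.mul_le_left)
  have hmem : r + 1 ∈ {n : ℕ | ∃ a : Fin n → MvPolynomial σ K,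
      (Ideal.span (Set.range a)).radical = I.radical} :=
    ⟨fun i => g i, by rw [hspan, hrad]⟩
  have hle : ara I ≤ r + 1 := Nat.sInf_le hmem
  obtain ⟨a, ha⟩ := Nat.sInf_mem ⟨_, hmem⟩
  have hge : projDim (MvPolynomial σ K) (MvPolynomial σ K ⧸ I) ≤ ara I :=
    projDim_le_of_radical_eq I hsf a ha
  exact ⟨⟨hJI, s, hs, hred⟩, by omega, by omega⟩
end

section
/- Let q ≥ 1 and h_1, ..., h_q ≥ 1 be integers, let K be a field, and let R = K[x_{ij} : 1 ≤ i ≤ q, 1 ≤ j ≤ h_i] be the polynomial ring in the variables x_{ij} over K. Let I = (x_{11}, ..., x_{1h_1}) ∩ (x_{21}, ..., x_{2h_2}) ∩ ... ∩ (x_{q1}, ..., x_{qh_q}). Set r = h_1 + h_2 + ... + h_q − q and, for each ℓ = 0, 1, ..., r, define g_ℓ = Σ x_{1ℓ_1} x_{2ℓ_2} ⋯ x_{qℓ_q}, where the sum runs over all tuples (ℓ_1, ..., ℓ_q) with 1 ≤ ℓ_j ≤ h_j and ℓ_1 + ... + ℓ_q = ℓ + q. Then J = (g_0, g_1, ...,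 g_r) is a reduction of I. -/
namespace Polynomial

variable {R : Type*} [CommRing R]

theorem prod_monomial_eq {ι : Type*} (s : Finset ι) (n : ι → ℕ) (a : ι → R) :
    ∏ i ∈ s, monomial (n i) (a i) = monomial (∑ i ∈ s, n i) (∏ i ∈ s, a i) := by
  classical
  induction s using Finset.induction_on with
  | empty => simp
  | insert i s hi ih =>
    rw [Finset.prod_insert hi, Finset.prod_insert hi, Finset.sum_insert hi, ih,
      monomial_mul_monomial]

theorem contentIdeal_le_iff {p : R[X]} {I : Ideal R} :
    p.contentIdeal ≤ I ↔ ∀ n, p.coeff n ∈ I := by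
  refine ⟨fun hp n => hp (p.coeff_mem_contentIdeal n), fun hp => ?_⟩
  rw [contentIdeal_def, Ideal.span_le]
  intro x hx
  obtain ⟨n, -, rfl⟩ := mem_coeffs_iff.1 hx
  exact hp n

theorem contentIdeal_sub_le (p q : R[X]) :
    (p - q).contentIdeal ≤ p.contentIdeal ⊔ q.contentIdeal := by
  rw [contentIdeal_le_iff]
  intro n
  rw [coeff_sub]
  exact sub_mem (Ideal.mem_sup_left (p.coeff_mem_contentIdeal n))
    (Ideal.mem_sup_right (q.coeff_mem_contentIdeal n))

theorem contentIdeal_le_span_sup_erase (p : R[X]) (n : ℕ) :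
    p.contentIdeal ≤ Ideal.span {p.coeff n} ⊔ (p.erase n).contentIdeal := by
  conv_lhs => rw [← monomial_add_erase p n, ← sub_neg_eq_add]
  refine (contentIdeal_sub_le _ _).trans (sup_le_sup (contentIdeal_monomial _ _).le ?_)
  rw [contentIdeal_le_iff]
  intro k
  rw [coeff_neg]
  exact neg_mem (coeff_mem_contentIdeal _ k)

theorem contentIdeal_erase_le (p : R[X]) (n : ℕ) :
    (p.erase n).contentIdeal ≤ p.contentIdeal := by
  rw [contentIdeal_le_iff]
  intro k
  rw [coeff_erase]
  split_ifs
  · exact zero_mem _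
  · exact p.coeff_mem_contentIdeal k

theorem contentIdeal_mul_erase_le (p q : R[X]) (n : ℕ) :
    (p * q.erase n).contentIdeal ≤
      (p * q).contentIdeal ⊔ Ideal.span {q.coeff n} * p.contentIdeal := by
  have h : p * q.erase n = p * q - monomial n (q.coeff n) * p := by
    conv_rhs => rw [← congrArg (p * ·) (monomial_add_erase q n)]
    ring
  rw [h]
  refine (contentIdeal_sub_le _ _).trans (sup_le_sup le_rfl ?_)
  exact (contentIdeal_mul_le_mul_contentIdeal _ _).trans_eq (by rw [contentIdeal_monomial])

theorem degree_erase_lt_of_degree_lt_succ {p : R[X]} {n : ℕ} (hp : p.degree < (n + 1 : ℕ)) :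
    (p.erase n).degree < n := by
  rw [degree_lt_iff_coeff_zero] at hp ⊢
  intro k hk
  rw [coeff_erase]
  split_ifs with h
  · rfl
  · exact hp k (by omega)

theorem coeff_mul_of_degree_lt_succ {p q : R[X]} {m n : ℕ} (hp : p.degree < (m + 1 : ℕ))
    (hq : q.degree < (n + 1 : ℕ)) : (p * q).coeff (m + n) = p.coeff m * q.coeff n :=
  coeff_mul_add_eq_of_natDegree_le
    (natDegree_le_iff_degree_le.2 (Order.lt_succ_iff.1 (by exact_mod_cast hp)))
    (natDegree_le_iff_degree_le.2 (Order.lt_succ_iff.1 (by exact_mod_cast hq)))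

theorem _root_.Ideal.sup_pow_succ_le (I J : Ideal R) (n : ℕ) :
    (I ⊔ J) ^ (n + 1) ≤ I * (I ⊔ J) ^ n ⊔ J ^ (n + 1) := by
  induction n with
  | zero => simp
  | succ n ih =>
    rw [pow_succ' _ (n + 1), Ideal.sup_mul]
    refine sup_le le_sup_left ((Ideal.mul_mono_right ih).trans ?_)
    rw [Ideal.mul_sup, ← pow_succ' J (n + 1)]
    refine sup_le_sup ?_ le_rfl
    rw [mul_left_comm, pow_succ' _ n]
    exact Ideal.mul_mono_right (Ideal.mul_mono_left le_sup_right)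

theorem contentIdeal_prod_le {ι : Type*} (s : Finset ι) (p : ι → R[X]) :
    (∏ i ∈ s, p i).contentIdeal ≤ ∏ i ∈ s, (p i).contentIdeal := by
  classical
  induction s using Finset.induction_on with
  | empty => simp
  | insert a s ha ih =>
    rw [Finset.prod_insert ha, Finset.prod_insert ha]
    exact (contentIdeal_mul_le_mul_contentIdeal _ _).trans (Ideal.mul_mono_right ih)

/-- The **Dedekind-Mertens lemma**. -/
theorem contentIdeal_pow_succ_mul_le {p q : R[X]} {m n : ℕ} (hp : p.degree < m)
    (hq : q.degree < (n + 1 : ℕ)) :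
    p.contentIdeal ^ (n + 1) * q.contentIdeal ≤ p.contentIdeal ^ n * (p * q).contentIdeal := by
  induction n generalizing m p q with
  | zero =>
    have hq0 : q.degree ≤ 0 := Order.lt_succ_iff.1 (by exact_mod_cast hq)
    rw [eq_C_of_degree_le_zero hq0, contentIdeal_C, zero_add, pow_one, pow_zero, Ideal.one_eq_top,
      Ideal.top_mul, mul_comm, Ideal.span_singleton_mul_le_iff]
    intro x hx
    rw [mul_comm p]
    induction hx using Submodule.span_induction with
    | mem x hx =>
      obtain ⟨k, -, rfl⟩ := mem_coeffs_iff.1 hx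
      rw [← coeff_C_mul]
      exact coeff_mem_contentIdeal _ k
    | zero => simp
    | add x y _ _ hx hy => rw [mul_add]; exact add_mem hx hy
    | smul a x _ hx => rw [smul_eq_mul, mul_left_comm]; exact Ideal.mul_mem_left _ _ hx
  | succ n ihn =>
    induction m generalizing p with
    | zero =>
      have hp0 : p = 0 := by simpa using hp
      simp [hp0]
    | succ m ihm =>
      have hab : Ideal.span {p.coeff m} * Ideal.span {q.coeff (n + 1)} ≤
          (p * q).contentIdeal := by
        rw [Ideal.span_singleton_mul_span_singleton, Ideal.span_singleton_le_iff_mem,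
          ← coeff_mul_of_degree_lt_succ hp hq]
        exact coeff_mem_contentIdeal _ _
      have hlead : Ideal.span {p.coeff m} * (p.contentIdeal ^ (n + 1) * q.contentIdeal) ≤
          p.contentIdeal ^ (n + 1) * (p * q).contentIdeal := by
        have ha : Ideal.span {p.coeff m} ≤ p.contentIdeal := by
          rw [Ideal.span_singleton_le_iff_mem]
          exact coeff_mem_contentIdeal _ _
        have hq1 : p.contentIdeal ^ (n + 1) * (q.erase (n + 1)).contentIdeal ≤
            p.contentIdeal ^ n * ((p * q).contentIdeal ⊔
              Ideal.span {q.coeff (n + 1)} * p.contentIdeal) :=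
          (ihn hp (degree_erase_lt_of_degree_lt_succ hq)).trans
            (Ideal.mul_mono_right (contentIdeal_mul_erase_le p q (n + 1)))
        generalize p.contentIdeal = A at *
        generalize (p * q).contentIdeal = C at *
        generalize Ideal.span {p.coeff m} = a at *
        have hB := contentIdeal_le_span_sup_erase q (n + 1)
        generalize Ideal.span {q.coeff (n + 1)} = b at *
        generalize (q.erase (n + 1)).contentIdeal = B₁ at *
        have hlow : a * (A ^ n * (b * A)) ≤ A ^ (n + 1) * C := by
          calc a * (A ^ n * (b * A)) = A ^ (n + 1) * (a * b) := by ring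
            _ ≤ A ^ (n + 1) * C := by gcongr
        calc a * (A ^ (n + 1) * q.contentIdeal)
            ≤ a * (A ^ (n + 1) * (b ⊔ B₁)) := by gcongr
          _ = a * (A ^ n * (b * A)) ⊔ a * (A ^ (n + 1) * B₁) := by
            rw [Ideal.mul_sup, Ideal.mul_sup, pow_succ, mul_assoc _ A b, mul_comm A b]
          _ ≤ A ^ (n + 1) * C := by
            refine sup_le hlow ((Ideal.mul_mono_right hq1).trans ?_)
            rw [Ideal.mul_sup, Ideal.mul_sup]
            refine sup_le ?_ hlow
            calc a * (A ^ n * C) ≤ A * (A ^ n * C) := by gcongr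
              _ = A ^ (n + 1) * C := by ring
      have hle := contentIdeal_erase_le p m
      have hsup : p.contentIdeal = Ideal.span {p.coeff m} ⊔ (p.erase m).contentIdeal :=
        le_antisymm (contentIdeal_le_span_sup_erase p m) (sup_le
          ((Ideal.span_singleton_le_iff_mem _).2 (coeff_mem_contentIdeal _ _)) hle)
      have hp1 := ihm (degree_erase_lt_of_degree_lt_succ hp)
      have hC : (p.erase m * q).contentIdeal ≤
          (p * q).contentIdeal ⊔ Ideal.span {p.coeff m} * q.contentIdeal := by
        simpa only [mul_comm] using contentIdeal_mul_erase_le q p m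
      have hpow := Ideal.sup_pow_succ_le (Ideal.span {p.coeff m}) (p.erase m).contentIdeal (n + 1)
      rw [← hsup] at hpow
      refine (Ideal.mul_mono_left hpow).trans ?_
      rw [Ideal.sup_mul, mul_assoc]
      refine sup_le hlead (hp1.trans ((Ideal.mul_mono_right hC).trans ?_))
      rw [Ideal.mul_sup]
      refine sup_le (by gcongr) (le_trans ?_ hlead)
      rw [mul_left_comm]
      gcongr

/-- The content ideal of a finite product is a reduction of the product of the content ideals. -/
theorem exists_prod_contentIdeal_pow_succ_le {ι : Type*} (s : Finset ι) (p : ι → R[X]) :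
    ∃ k, (∏ i ∈ s, (p i).contentIdeal) ^ (k + 1) ≤
      (∏ i ∈ s, p i).contentIdeal * (∏ i ∈ s, (p i).contentIdeal) ^ k := by
  classical
  induction s using Finset.induction_on with
  | empty => exact ⟨0, by simp⟩
  | insert a s ha ih =>
    obtain ⟨k, hk⟩ := ih
    rw [Finset.prod_insert ha, Finset.prod_insert ha]
    obtain ⟨n, hn⟩ : ∃ n : ℕ, n = (∏ i ∈ s, p i).natDegree := ⟨_, rfl⟩
    have hdm := contentIdeal_pow_succ_mul_le (p := p a) (q := ∏ i ∈ s, p i) (n := n)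
      (degree_lt_iff_coeff_zero _ _ |>.2 fun j hj => coeff_eq_zero_of_natDegree_lt hj :
        (p a).degree < ((p a).natDegree + 1 : ℕ))
      (degree_lt_iff_coeff_zero _ _ |>.2 fun j hj => coeff_eq_zero_of_natDegree_lt (by omega))
    have hle := contentIdeal_prod_le s p
    generalize (p a).contentIdeal = A at *
    generalize (∏ i ∈ s, p i).contentIdeal = E at *
    generalize ∏ i ∈ s, (p i).contentIdeal = D at *
    generalize (p a * ∏ i ∈ s, p i).contentIdeal = C at *
    have hiter : ∀ j, D ^ (k + j) ≤ E ^ j * D ^ k := by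
      intro j
      induction j with
      | zero => simp
      | succ j ihj =>
        calc D ^ (k + (j + 1)) = D * D ^ (k + j) := by ring
          _ ≤ D * (E ^ j * D ^ k) := by gcongr
          _ = E ^ j * D ^ (k + 1) := by ring
          _ ≤ E ^ j * (E * D ^ k) := by gcongr
          _ = E ^ (j + 1) * D ^ k := by ring
    refine ⟨k + n, ?_⟩
    calc (A * D) ^ (k + n + 1) = A ^ (k + n + 1) * D ^ (k + (n + 1)) := by ring
      _ ≤ A ^ (k + n + 1) * (E ^ (n + 1) * D ^ k) := by gcongr; exact hiter _
      _ = A ^ k * D ^ k * E ^ n * (A ^ (n + 1) * E) := by ring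
      _ ≤ A ^ k * D ^ k * D ^ n * (A ^ n * C) := by gcongr
      _ = C * (A * D) ^ (k + n) := by ring

end Polynomial

namespace MvPolynomial

variable {R : Type*} [CommRing R]

theorem iInf_span_X_fiber_le_prod {ι : Type*} [Fintype ι] {κ : ι → Type*} :
    (⨅ i, Ideal.span (Set.range fun j : κ i => (X ⟨i, j⟩ : MvPolynomial (Σ i, κ i) R))) ≤
      ∏ i, Ideal.span (Set.range fun j : κ i => (X ⟨i, j⟩ : MvPolynomial (Σ i, κ i) R)) := by
  classical
  intro x hx
  have hrange : ∀ i, (Set.range fun j : κ i => (X ⟨i, j⟩ : MvPolynomial (Σ i, κ i) R)) =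
      X '' Set.range (fun j : κ i => (⟨i, j⟩ : Σ i, κ i)) := fun i => by
    rw [← Set.range_comp]; rfl
  rw [Ideal.mem_iInf] at hx
  rw [x.as_sum]
  refine Ideal.sum_mem _ fun m hm => ?_
  have hdvd : ∀ i, ∃ j : κ i, m ⟨i, j⟩ ≠ 0 := fun i => by
    have hi := hx i
    rw [hrange, mem_ideal_span_X_image] at hi
    obtain ⟨_, ⟨j, rfl⟩, hj⟩ := hi m hm
    exact ⟨j, hj⟩
  choose f hf using hdvd
  have hmem : (∏ i, (X ⟨i, f i⟩ : MvPolynomial (Σ i, κ i) R)) ∈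
      ∏ i, Ideal.span (Set.range fun j : κ i => (X ⟨i, j⟩ : MvPolynomial (Σ i, κ i) R)) :=
    Ideal.prod_mem_prod fun i _ => Ideal.subset_span ⟨f i, rfl⟩
  have hmono : (∏ i, (X ⟨i, f i⟩ : MvPolynomial (Σ i, κ i) R)) =
      monomial (∑ i, Finsupp.single ⟨i, f i⟩ 1) 1 :=
    (monomial_sum_one _ _).symm
  refine Ideal.mem_of_dvd _ ?_ hmem
  rw [hmono]
  refine monomial_dvd_monomial.2 ⟨Or.inr ?_, one_dvd _⟩
  rintro ⟨i, j⟩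
  rw [Finsupp.finsetSum_apply, Finset.sum_eq_single i]
  · rw [Finsupp.single_apply]
    split_ifs with h
    · rw [← h]; exact Nat.one_le_iff_ne_zero.2 (hf i)
    · exact Nat.zero_le _
  · intro b _ hb
    rw [Finsupp.single_apply, if_neg]
    intro h
    exact hb (congrArg Sigma.fst h)
  · simp

end MvPolynomial

open MvPolynomial in
/-- The Alexander dual of a complete intersection monomial ideal admits a
minimal reduction generated by `r + 1` sums of monomials. -/
theorem reduction_of_alexander_dual_of_CI
    (q : ℕ) (hq : 1 ≤ q) (h : Fin q → ℕ) (hh : ∀ i, 1 ≤ h i)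
    (K : Type*) [Field K]
    (I : Ideal (MvPolynomial (Σ i : Fin q, Fin (h i)) K))
    (hI : I = ⨅ i : Fin q,
      Ideal.span (Set.range fun j : Fin (h i) => (X ⟨i, j⟩ : MvPolynomial (Σ i : Fin q, Fin (h i)) K)))
    (r : ℕ) (hr : r = (∑ i, h i) - q)
    (g : ℕ → MvPolynomial (Σ i : Fin q, Fin (h i)) K)
    (hg : ∀ ℓ, g ℓ = ∑ f ∈ Finset.univ.filter
        (fun f : (i : Fin q) → Fin (h i) => (∑ i, (f i : ℕ)) = ℓ),
      ∏ i : Fin q, X ⟨i, f i⟩)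
    (J : Ideal (MvPolynomial (Σ i : Fin q, Fin (h i)) K))
    (hJ : J = Ideal.span {x | ∃ ℓ ≤ r, x = g ℓ}) :
    J ≤ I ∧ ∃ s : ℕ, 1 ≤ s ∧ I ^ (s + 1) = J * I ^ s := by
  classical
  let P : Fin q → Polynomial (MvPolynomial (Σ i : Fin q, Fin (h i)) K) :=
    fun i => ∑ j : Fin (h i), Polynomial.monomial (j : ℕ) (X ⟨i, j⟩)
  have hPcoeff : ∀ i n, (P i).coeff n =
      ∑ j : Fin (h i), if (j : ℕ) = n then X ⟨i, j⟩ else 0 := fun i n => by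
    simp [P, Polynomial.coeff_monomial]
  have hPcontent : ∀ i, (P i).contentIdeal = Ideal.span (Set.range fun j : Fin (h i) =>
      (X ⟨i, j⟩ : MvPolynomial (Σ i : Fin q, Fin (h i)) K)) := fun i => by
    refine le_antisymm (Polynomial.contentIdeal_le_iff.2 fun n => ?_) (Ideal.span_le.2 ?_)
    · rw [hPcoeff]
      refine Ideal.sum_mem _ fun j _ => ?_
      split_ifs
      · exact Ideal.subset_span ⟨j, rfl⟩
      · exact zero_mem _
    · rintro _ ⟨j, rfl⟩
      have hj : (P i).coeff j = X ⟨i, j⟩ := by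
        simp [hPcoeff, Fin.val_inj]
      change X _ ∈ _
      rw [← hj]
      exact Polynomial.coeff_mem_contentIdeal _ _
  have hgcoeff : ∀ ℓ, (∏ i, P i).coeff ℓ = g ℓ := fun ℓ => by
    simp only [P]
    rw [Finset.prod_univ_sum, Polynomial.finsetSum_coeff, hg, Finset.sum_filter,
      Fintype.piFinset_univ]
    refine Finset.sum_congr rfl fun f _ => ?_
    rw [Polynomial.prod_monomial_eq, Polynomial.coeff_monomial]
  have hgzero : ∀ ℓ, r < ℓ → g ℓ = 0 := fun ℓ hℓ => by
    rw [hg, Finset.filter_false_of_mem, Finset.sum_empty]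
    intro f _ hf
    have hsum : ∑ i, ((f i : ℕ) + 1) ≤ ∑ i, h i := Finset.sum_le_sum fun i _ => (f i).isLt
    rw [Finset.sum_add_distrib, Finset.sum_const, Finset.card_univ, Fintype.card_fin] at hsum
    simp only [smul_eq_mul, mul_one] at hsum
    omega
  have hJcontent : J = (∏ i, P i).contentIdeal := by
    rw [hJ]
    refine le_antisymm (Ideal.span_le.2 ?_) (Polynomial.contentIdeal_le_iff.2 fun n => ?_)
    · rintro _ ⟨ℓ, -, rfl⟩
      rw [← hgcoeff]
      exact Polynomial.coeff_mem_contentIdeal _ _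
    · rw [hgcoeff]
      rcases le_or_gt n r with hn | hn
      · exact Ideal.subset_span ⟨n, hn, rfl⟩
      · rw [hgzero n hn]
        exact zero_mem _
  have hIcontent : I = ∏ i, (P i).contentIdeal := by
    simp only [hI, hPcontent]
    exact le_antisymm iInf_span_X_fiber_le_prod (Ideal.prod_le_inf.trans (Finset.inf_univ_eq_iInf _).le)
  have hle : J ≤ I := by
    rw [hJcontent, hIcontent]
    exact Polynomial.contentIdeal_prod_le _ _
  obtain ⟨k, hk⟩ := Polynomial.exists_prod_contentIdeal_pow_succ_le Finset.univ P
  rw [← hJcontent, ← hIcontent] at hk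
  refine ⟨hle, k + 1, by omega, le_antisymm ?_ ?_⟩
  · calc I ^ (k + 1 + 1) = I ^ (k + 1) * I := pow_succ _ _
      _ ≤ J * I ^ k * I := by gcongr
      _ = J * I ^ (k + 1) := by ring
  · rw [pow_succ' I (k + 1)]
    gcongr
end

section
/- Let q ≥ 1 and h_1, ..., h_q ≥ 1 be integers, let K be a field, and let R = K[x_{ij} : 1 ≤ i ≤ q, 1 ≤ j ≤ h_i]. Let I be the ideal generated by all monomials x_{1ℓ_1} x_{2ℓ_2} ⋯ x_{qℓ_q} with 1 ≤ ℓ_j ≤ h_j. For each ℓ ≥ 0 let P_ℓ = { x_{1ℓ_1} ⋯ x_{qℓ_q} : 1 ≤ ℓ_j ≤ h_j, ℓ_1 + ... + ℓ_q = ℓ + q }. Then for every ℓ > 0 and all distinct monomials a = x_{1i_1} x_{2i_2} ⋯ x_{qi_q} and a'' = x_{1j_1} x_{2j_2} ⋯ x_{qj_q} in P_ℓ, there exist an integer ℓ' with 0 ≤ ℓ' < ℓ and elements a' ∈ P_{ℓ'} and b ∈ I such that a·a'' = a'·b. -/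
open MvPolynomial in
/-- The Schmitt–Vogel condition (SV3) holds for the natural partition of the
generators of the Alexander dual of a complete intersection monomial ideal. -/
theorem sv3_for_alexander_dual_of_CI
    (q : ℕ) (hq : 1 ≤ q) (h : Fin q → ℕ) (hh : ∀ i, 1 ≤ h i)
    (K : Type*) [Field K]
    (I : Ideal (MvPolynomial (Σ i : Fin q, Fin (h i)) K))
    (hI : I = Ideal.span (Set.range fun f : (i : Fin q) → Fin (h i) =>
      ∏ i : Fin q, (X ⟨i, f i⟩ : MvPolynomial (Σ i : Fin q, Fin (h i)) K)))
    (P : ℕ → Set (MvPolynomial (Σ i : Fin q, Fin (h i)) K))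
    (hP : ∀ ℓ, P ℓ = {p | ∃ f : (i : Fin q) → Fin (h i),
      (∑ i, (f i : ℕ)) = ℓ ∧ p = ∏ i : Fin q, X ⟨i, f i⟩}) :
    ∀ ℓ, 0 < ℓ → ∀ f f'' : (i : Fin q) → Fin (h i),
      (∑ i, (f i : ℕ)) = ℓ → (∑ i, (f'' i : ℕ)) = ℓ →
      (∏ i : Fin q, (X ⟨i, f i⟩ : MvPolynomial (Σ i : Fin q, Fin (h i)) K)) ≠
        ∏ i : Fin q, X ⟨i, f'' i⟩ →
      ∃ ℓ' < ℓ, ∃ a' ∈ P ℓ', ∃ b ∈ I,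
        (∏ i : Fin q, (X ⟨i, f i⟩ : MvPolynomial (Σ i : Fin q, Fin (h i)) K)) *
          (∏ i : Fin q, X ⟨i, f'' i⟩) = a' * b := by
  subst hI
  intro ℓ _ f f'' hf hf'' hne
  refine ⟨∑ i, (min (f i) (f'' i) : ℕ), ?_, ∏ i, X ⟨i, min (f i) (f'' i)⟩, ?_,
    ∏ i, X ⟨i, max (f i) (f'' i)⟩,
    Ideal.subset_span ⟨fun i => max (f i) (f'' i), rfl⟩, ?_⟩
  · by_contra! hle
    have eq_of_le_min : ∀ g : (i : Fin q) → Fin (h i), (∑ i, (g i : ℕ)) = ℓ →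
        (∀ i, min (f i : ℕ) (f'' i) ≤ g i) → ∀ i, min (f i : ℕ) (f'' i) = g i := by
      intro g hg hmin i
      refine (Finset.sum_eq_sum_iff_of_le fun i _ => hmin i).1 ?_ i (Finset.mem_univ i)
      exact le_antisymm (Finset.sum_le_sum fun i _ => hmin i) (hg.trans_le hle)
    apply hne
    have : f = f'' := by
      ext i
      exact (eq_of_le_min f hf (fun i => min_le_left _ _) i).symm.trans
        (eq_of_le_min f'' hf'' (fun i => min_le_right _ _) i)
    rw [this]
  · rw [hP]
    refine ⟨fun i => min (f i) (f'' i), Finset.sum_congr rfl fun i _ => ?_, rfl⟩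
    exact Fin.coe_min _ _
  · rw [← Finset.prod_mul_distrib, ← Finset.prod_mul_distrib]
    refine Finset.prod_congr rfl fun i _ => ?_
    rcases le_total (f i) (f'' i) with hle | hle
    · rw [min_eq_left hle, max_eq_right hle]
    · rw [min_eq_right hle, max_eq_left hle, mul_comm]
end

section
/- Let R be a commutative Noetherian ring, let P be a finite subset of R, and let I = (P). Let P_0, P_1, ..., P_r be subsets of P such that: (B1) P = P_0 ∪ P_1 ∪ ... ∪ P_r; (B2) P_0 has exactly one element; (B3) for each ℓ with 0 < ℓ ≤ r and every a, a'' ∈ P_ℓ with a ≠ a'', there exists an integer m ≥ 1 such that (a·a'')^m ∈ (P_0 ∪ ... ∪ P_{ℓ−1})·I^{2m−1}, where (P_0 ∪ ... ∪ P_{ℓ−1}) denotes the ideal generated by P_0 ∪ ... ∪ P_{ℓ−1}. For ℓ = 0, 1, ..., r set g_ℓ = Σ_{a ∈ P_ℓ} a. Then J = (g_0, g_1, ..., g_r) is a reduction of I. -/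
open Polynomial in
/-- The degree `n` part of an ideal of the Rees algebra of `I`, as an ideal of the base ring. -/
def reesDegreePart {R : Type*} [CommRing R] {I : Ideal R} (𝔞 : Ideal (reesAlgebra I)) (n : ℕ) :
    Ideal R where
  carrier := {x | ∃ f ∈ 𝔞, (f : R[X]) = monomial n x}
  add_mem' := by
    rintro x y ⟨f, hf, hfx⟩ ⟨g, hg, hgy⟩
    exact ⟨f + g, 𝔞.add_mem hf hg, by simp [hfx, hgy]⟩
  zero_mem' := ⟨0, 𝔞.zero_mem, by simp⟩
  smul_mem' := by
    rintro c x ⟨f, hf, hfx⟩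
    refine ⟨algebraMap R _ c * f, 𝔞.mul_mem_left _ hf, ?_⟩
    rw [← Algebra.smul_def]
    simp [hfx, smul_monomial]

/-- The ideal of the Rees algebra of `I` whose degree `n` part is contained in `J * I ^ (n - 1)`. -/
def reesReductionIdeal {R : Type*} [CommRing R] (I J : Ideal R) : Ideal (reesAlgebra I) where
  carrier := {f | ∀ n, (f : Polynomial R).coeff n ∈ J * I ^ (n - 1)}
  add_mem' := fun hf hg n => by
    simpa using Ideal.add_mem _ (hf n) (hg n)
  zero_mem' := fun n => by simp
  smul_mem' := fun c f hf n => by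
    simp only [smul_eq_mul, Subalgebra.coe_mul, Polynomial.coeff_mul]
    refine Ideal.sum_mem _ fun ij hij => ?_
    have h := Ideal.mul_mem_mul (c.2 ij.1) (hf ij.2)
    rw [mul_left_comm, ← pow_add] at h
    have hsum := Finset.HasAntidiagonal.mem_antidiagonal.mp hij
    exact Ideal.mul_mono_right (Ideal.pow_le_pow_right (by omega)) h

section ReesDegreePart

variable {R : Type*} [CommRing R] {I : Ideal R}

open Polynomial

theorem reesDegreePart_mono {𝔞 𝔟 : Ideal (reesAlgebra I)} (h : 𝔞 ≤ 𝔟) (n : ℕ) :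
    reesDegreePart 𝔞 n ≤ reesDegreePart 𝔟 n :=
  fun _ ⟨f, hf, hfx⟩ => ⟨f, h hf, hfx⟩

theorem pow_le_reesDegreePart_top (n : ℕ) :
    I ^ n ≤ reesDegreePart (⊤ : Ideal (reesAlgebra I)) n :=
  fun _ hx => ⟨⟨_, reesAlgebra.monomial_mem.mpr hx⟩, trivial, rfl⟩

theorem reesDegreePart_mul_le (𝔞 𝔟 : Ideal (reesAlgebra I)) (m n : ℕ) :
    reesDegreePart 𝔞 m * reesDegreePart 𝔟 n ≤ reesDegreePart (𝔞 * 𝔟) (m + n) := by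
  rw [Ideal.mul_le]
  rintro x ⟨f, hf, hfx⟩ y ⟨g, hg, hgy⟩
  exact ⟨f * g, Ideal.mul_mem_mul hf hg, by simp [hfx, hgy, monomial_mul_monomial]⟩

theorem reesDegreePart_mul_pow_le (𝔞 : Ideal (reesAlgebra I)) (m n : ℕ) :
    reesDegreePart 𝔞 m * I ^ n ≤ reesDegreePart 𝔞 (m + n) :=
  (Ideal.mul_mono_right (pow_le_reesDegreePart_top n)).trans <|
    (reesDegreePart_mul_le 𝔞 ⊤ m n).trans (reesDegreePart_mono Ideal.mul_le_left _)

theorem reesDegreePart_one_pow_le (𝔞 : Ideal (reesAlgebra I)) (n : ℕ) :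
    reesDegreePart 𝔞 1 ^ n ≤ reesDegreePart (𝔞 ^ n) n := by
  induction n with
  | zero => simpa using pow_le_reesDegreePart_top (I := I) 0
  | succ n ih =>
    rw [pow_succ, pow_succ]
    exact (Ideal.mul_mono_left ih).trans (reesDegreePart_mul_le _ _ _ _)

theorem mem_reesDegreePart_radical_of_pow {𝔞 : Ideal (reesAlgebra I)} {n m : ℕ} {x : R}
    (hx : x ∈ I ^ n) (h : x ^ m ∈ reesDegreePart 𝔞.radical (n * m)) :
    x ∈ reesDegreePart 𝔞.radical n := by
  obtain ⟨f, hf, hfx⟩ := h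
  refine ⟨⟨monomial n x, reesAlgebra.monomial_mem.mpr hx⟩, ?_, rfl⟩
  refine (Ideal.radical_isRadical 𝔞) ⟨m, ?_⟩
  convert hf using 1
  exact Subtype.ext (by simp [hfx, monomial_pow])

theorem reesDegreePart_reesReductionIdeal_le (J : Ideal R) (n : ℕ) :
    reesDegreePart (reesReductionIdeal I J) n ≤ J * I ^ (n - 1) := by
  rintro x ⟨f, hf, hfx⟩
  simpa [hfx] using hf n

theorem le_reesDegreePart_reesReductionIdeal {J : Ideal R} (hJI : J ≤ I) :
    J ≤ reesDegreePart (reesReductionIdeal I J) 1 := by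
  intro x hx
  refine ⟨⟨monomial 1 x, reesAlgebra.monomial_mem.mpr (by simpa using hJI hx)⟩, fun n => ?_, rfl⟩
  by_cases hn : n = 1
  · subst hn
    simpa using hx
  · simp [coeff_monomial, Ne.symm hn]

/-- If every element of `I` becomes nilpotent in the Rees algebra modulo `J`, then `J` is a
reduction of `I`. -/
theorem exists_pow_succ_eq_mul_pow_of_le_reesDegreePart_radical [IsNoetherianRing R]
    {J : Ideal R} (hJI : J ≤ I)
    (h : I ≤ reesDegreePart (reesReductionIdeal I J).radical 1) :
    ∃ s : ℕ, 1 ≤ s ∧ I ^ (s + 1) = J * I ^ s := by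
  obtain ⟨k, hk⟩ := Ideal.exists_radical_pow_le_of_fg (reesReductionIdeal I J)
    (IsNoetherian.noetherian _)
  refine ⟨k + 1, by omega, le_antisymm ?_ ?_⟩
  · calc I ^ (k + 1 + 1)
        ≤ reesDegreePart (reesReductionIdeal I J).radical 1 ^ (k + 1 + 1) :=
          Ideal.pow_right_mono h _
      _ ≤ reesDegreePart ((reesReductionIdeal I J).radical ^ (k + 1 + 1)) (k + 1 + 1) :=
          reesDegreePart_one_pow_le _ _
      _ ≤ reesDegreePart (reesReductionIdeal I J) (k + 1 + 1) :=
          reesDegreePart_mono ((Ideal.pow_le_pow_right (by omega)).trans hk) _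
      _ ≤ J * I ^ (k + 1) := reesDegreePart_reesReductionIdeal_le J _
  · rw [pow_succ' I (k + 1)]
    exact Ideal.mul_mono_left hJI

end ReesDegreePart


/-- Barile type lemma for reductions (Theorem 2.1 analogue). -/
theorem barile_type_lemma_for_reductions
    {R : Type*} [CommRing R] [IsNoetherianRing R]
    (P : Finset R) (r : ℕ) (𝓟 : ℕ → Finset R)
    (hsub : ∀ ℓ ≤ r, 𝓟 ℓ ⊆ P)
    (I : Ideal R) (hI : I = Ideal.span (P : Set R))
    (hB1 : (P : Set R) = ⋃ ℓ ≤ r, (𝓟 ℓ : Set R))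
    (hB2 : (𝓟 0).card = 1)
    (hB3 : ∀ ℓ, 0 < ℓ → ℓ ≤ r → ∀ a ∈ 𝓟 ℓ, ∀ a'' ∈ 𝓟 ℓ, a ≠ a'' →
      ∃ m : ℕ, 1 ≤ m ∧
        (a * a'') ^ m ∈ Ideal.span (⋃ k ≤ ℓ - 1, (𝓟 k : Set R)) * I ^ (2 * m - 1))
    (g : ℕ → R) (hg : ∀ ℓ ≤ r, g ℓ = ∑ a ∈ 𝓟 ℓ, a)
    (J : Ideal R) (hJ : J = Ideal.span {x | ∃ ℓ ≤ r, x = g ℓ}) :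
    J ≤ I ∧ ∃ s : ℕ, 1 ≤ s ∧ I ^ (s + 1) = J * I ^ s := by
  have hPI : ∀ ℓ ≤ r, ∀ a ∈ 𝓟 ℓ, a ∈ I := fun ℓ hℓ a ha =>
    hI ▸ Ideal.subset_span (hsub ℓ hℓ ha)
  have hJI : J ≤ I := by
    rw [hJ, Ideal.span_le]
    rintro _ ⟨ℓ, hℓ, rfl⟩
    rw [hg ℓ hℓ]
    exact Ideal.sum_mem _ fun a ha => hPI ℓ hℓ a ha
  have hgrad : ∀ ℓ ≤ r, g ℓ ∈ reesDegreePart (reesReductionIdeal I J).radical 1 := fun ℓ hℓ =>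
    reesDegreePart_mono Ideal.le_radical 1 <| le_reesDegreePart_reesReductionIdeal hJI <|
      hJ ▸ Ideal.subset_span ⟨ℓ, hℓ, rfl⟩
  refine ⟨hJI, exists_pow_succ_eq_mul_pow_of_le_reesDegreePart_radical hJI ?_⟩
  have key : ∀ ℓ ≤ r, ∀ a ∈ 𝓟 ℓ, a ∈ reesDegreePart (reesReductionIdeal I J).radical 1 := by
    intro ℓ
    induction ℓ using Nat.strong_induction_on with
    | _ ℓ ih =>
    intro hℓ a ha
    rcases Nat.eq_zero_or_pos ℓ with rfl | hpos
    · obtain ⟨p, hp⟩ := Finset.card_eq_one.mp hB2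
      have h0 := hgrad 0 hℓ
      rw [hg 0 hℓ, hp, Finset.sum_singleton] at h0
      rw [hp, Finset.mem_singleton] at ha
      rwa [ha]
    · have hspan : Ideal.span (⋃ k ≤ ℓ - 1, (𝓟 k : Set R)) ≤
          reesDegreePart (reesReductionIdeal I J).radical 1 := by
        refine Ideal.span_le.mpr (Set.iUnion₂_subset fun k hk b hb => ?_)
        exact ih k (by omega) (by omega) b hb
      have hprod : ∀ b ∈ 𝓟 ℓ, a ≠ b →
          a * b ∈ reesDegreePart (reesReductionIdeal I J).radical 2 := by
        intro b hb hab
        obtain ⟨m, hm, hmem⟩ := hB3 ℓ hpos hℓ a ha b hb hab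
        refine mem_reesDegreePart_radical_of_pow (m := m) ?_ ?_
        · rw [pow_two]
          exact Ideal.mul_mem_mul (hPI ℓ hℓ a ha) (hPI ℓ hℓ b hb)
        · have h := reesDegreePart_mul_pow_le _ 1 (2 * m - 1) (Ideal.mul_mono_left hspan hmem)
          rwa [show 1 + (2 * m - 1) = 2 * m by omega] at h
      refine mem_reesDegreePart_radical_of_pow (m := 2) (by simpa using hPI ℓ hℓ a ha) ?_
      classical
      have hsq : a ^ 2 = g ℓ * a - ∑ b ∈ (𝓟 ℓ).erase a, a * b := by
        rw [hg ℓ hℓ, ← Finset.add_sum_erase _ _ ha, ← Finset.mul_sum]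
        ring
      rw [hsq]
      refine Ideal.sub_mem _ ?_ (Ideal.sum_mem _ fun b hb => ?_)
      · exact reesDegreePart_mul_pow_le _ 1 1
          (Ideal.mul_mem_mul (hgrad ℓ hℓ) (by simpa using hPI ℓ hℓ a ha))
      · exact hprod b (Finset.mem_of_mem_erase hb) (Finset.ne_of_mem_erase hb).symm
  conv_lhs => rw [hI]
  rw [Ideal.span_le, hB1]
  exact Set.iUnion₂_subset key
end

section
/- Let K be a field, let m ≥ 2 be an integer, and let R = K[[x, y, z]]/(x^m y^m − z^{2m}) be the quotient of the formal power series ring in three variables by the principal ideal generated by x^m y^m − z^{2m}. Let I = (x, y, z)R be the ideal of R generated by the images of x, y, z. Then the ideal J = (x + y, z)R is a reduction of I. -/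
/-- The powers of `J + (x)` are generated by `x ^ (n + 1)` modulo `J * (J + (x)) ^ n`. -/
theorem Ideal.sup_span_singleton_pow_succ_le {A : Type*} [CommRing A] (J : Ideal A) (x : A)
    (n : ℕ) :
    (J ⊔ Ideal.span {x}) ^ (n + 1) ≤
      J * (J ⊔ Ideal.span {x}) ^ n ⊔ Ideal.span {x ^ (n + 1)} := by
  induction n with
  | zero => simp
  | succ n ih =>
    set I := J ⊔ Ideal.span {x} with hI
    have hx : Ideal.span {x ^ (n + 1)} ≤ I ^ (n + 1) := by
      rw [← Ideal.span_singleton_pow]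
      exact Ideal.pow_right_mono le_sup_right _
    calc I ^ (n + 1 + 1) = I * I ^ (n + 1) := pow_succ' _ _
      _ ≤ I * (J * I ^ n ⊔ Ideal.span {x ^ (n + 1)}) := Ideal.mul_mono_right ih
      _ = J * I ^ (n + 1) ⊔ (J * Ideal.span {x ^ (n + 1)} ⊔ Ideal.span {x ^ (n + 1 + 1)}) := by
        rw [Ideal.mul_sup, mul_left_comm, ← pow_succ']
        nth_rewrite 2 [hI]
        rw [Ideal.sup_mul, Ideal.span_singleton_mul_span_singleton, ← pow_succ']
      _ ≤ J * I ^ (n + 1) ⊔ Ideal.span {x ^ (n + 1 + 1)} :=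
        sup_le le_sup_left (sup_le_sup_right (Ideal.mul_mono_right hx) _)

/-- If `J + (x) = I` and `x ^ (n + 1) ∈ J * I ^ n`, then `I ^ (n + 1) = J * I ^ n`. -/
theorem Ideal.pow_succ_eq_mul_pow_of_mem {A : Type*} [CommRing A] {I J : Ideal A} {x : A} {n : ℕ}
    (hI : I = J ⊔ Ideal.span {x}) (hx : x ^ (n + 1) ∈ J * I ^ n) :
    I ^ (n + 1) = J * I ^ n := by
  apply le_antisymm
  · subst hI
    exact (Ideal.sup_span_singleton_pow_succ_le J x n).trans
      (sup_le le_rfl ((Ideal.span_singleton_le_iff_mem _).2 hx))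
  · rw [pow_succ']
    exact Ideal.mul_mono_left (hI ▸ le_sup_left)

/-- If `x ^ m * y ^ m = z ^ (2 * m)`, then `x ^ (2 * m)` lies in
`(x + y, z) * (x, y, z) ^ (2 * m - 1)`. -/
theorem pow_two_mul_mem_mul_pow {A : Type*} [CommRing A] {I J : Ideal A} {x y z : A} {k : ℕ}
    (hx : x ∈ I) (hy : y ∈ I) (hz : z ∈ I) (hxy : x + y ∈ J) (hzJ : z ∈ J)
    (h : x ^ (k + 1) * y ^ (k + 1) = z ^ (2 * (k + 1))) :
    x ^ (2 * k + 1 + 1) ∈ J * I ^ (2 * k + 1) := by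
  have hq : ∑ i ∈ Finset.range (k + 1), x ^ i * (-y) ^ (k + 1 - 1 - i) ∈ I ^ k := by
    refine Ideal.sum_mem _ fun i hi => ?_
    have hik : i + (k + 1 - 1 - i) = k := by
      have := Finset.mem_range.1 hi
      omega
    rw [← hik, pow_add, hik]
    exact Ideal.mul_mem_mul (Ideal.pow_mem_pow hx _) (Ideal.pow_mem_pow (I.neg_mem hy) _)
  have hgeom := (Commute.all x (-y)).mul_geom_sum₂ (k + 1)
  set q := ∑ i ∈ Finset.range (k + 1), x ^ i * (-y) ^ (k + 1 - 1 - i)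
  have key : x ^ (2 * k + 1 + 1) =
      (x + y) * (x ^ (k + 1) * q) + (-1) ^ (k + 1) * (z * z ^ (2 * k + 1)) := by
    rw [neg_pow] at hgeom
    linear_combination (-x ^ (k + 1)) * hgeom + (-1) ^ (k + 1) * h
  rw [key]
  refine Ideal.add_mem _ (Ideal.mul_mem_mul hxy ?_)
    (Ideal.mul_mem_left _ _ (Ideal.mul_mem_mul hzJ (Ideal.pow_mem_pow hz _)))
  rw [show 2 * k + 1 = k + 1 + k by ring, pow_add]
  exact Ideal.mul_mem_mul (Ideal.pow_mem_pow hx _) hq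

open MvPowerSeries in
/-- In the hypersurface `R = K[[x,y,z]]/(x^m y^m - z^{2m})`, the ideal
`(x + y, z)` is a reduction of `(x, y, z)`. -/
theorem reduction_in_hypersurface
    {K : Type*} [Field K] (m : ℕ) (hm : 2 ≤ m)
    (P : Ideal (MvPowerSeries (Fin 3) K))
    (hP : P = Ideal.span
      {(X 0 : MvPowerSeries (Fin 3) K) ^ m * X 1 ^ m - X 2 ^ (2 * m)})
    (I J : Ideal (MvPowerSeries (Fin 3) K ⧸ P))
    (hI : I = Ideal.span
      {Ideal.Quotient.mk P (X 0), Ideal.Quotient.mk P (X 1), Ideal.Quotient.mk P (X 2)})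
    (hJ : J = Ideal.span
      {Ideal.Quotient.mk P (X 0 + X 1), Ideal.Quotient.mk P (X 2)}) :
    J ≤ I ∧ ∃ s : ℕ, 1 ≤ s ∧ I ^ (s + 1) = J * I ^ s := by
  obtain ⟨k, rfl⟩ : ∃ k, m = k + 1 := ⟨m - 1, by omega⟩
  rw [map_add] at hJ
  set x := Ideal.Quotient.mk P (X 0)
  set y := Ideal.Quotient.mk P (X 1)
  set z := Ideal.Quotient.mk P (X 2)
  have hrel : x ^ (k + 1) * y ^ (k + 1) = z ^ (2 * (k + 1)) := by
    simp only [x, y, z, ← map_pow, ← map_mul]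
    rw [Ideal.Quotient.eq, hP]
    exact Ideal.mem_span_singleton_self _
  have hx : x ∈ I := hI ▸ Ideal.subset_span (by simp)
  have hy : y ∈ I := hI ▸ Ideal.subset_span (by simp)
  have hz : z ∈ I := hI ▸ Ideal.subset_span (by simp)
  have hxy : x + y ∈ J := hJ ▸ Ideal.subset_span (by simp)
  have hzJ : z ∈ J := hJ ▸ Ideal.subset_span (by simp)
  have hJI : J ≤ I := by
    rw [hJ, Ideal.span_le]
    rintro a (rfl | rfl)
    exacts [I.add_mem hx hy, hz]
  have hsup : I = J ⊔ Ideal.span {x} := by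
    apply le_antisymm
    · have hxS : x ∈ J ⊔ Ideal.span {x} :=
        Ideal.mem_sup_right (Ideal.mem_span_singleton_self x)
      rw [hI, Ideal.span_le]
      rintro a (rfl | rfl | rfl)
      · exact hxS
      · exact (Ideal.add_mem_iff_right _ hxS).1 (Ideal.mem_sup_left hxy)
      · exact Ideal.mem_sup_left hzJ
    · exact sup_le hJI ((Ideal.span_singleton_le_iff_mem _).2 hx)
  exact ⟨hJI, 2 * k + 1, by omega, Ideal.pow_succ_eq_mul_pow_of_mem hsup
    (pow_two_mul_mem_mul_pow hx hy hz hxy hzJ hrel)⟩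
end

section
/- Let R = K[x_1, x_2, x_3, x_4, x_5, x_6] be a polynomial ring over a field K, and let I = (x_1x_2 + x_1x_3, x_1x_4, x_1x_5, x_1x_6, x_2x_5, x_2x_6, x_3x_4, x_3x_6, x_4x_5, x_4x_6, x_5x_6). Then the ideal J = (x_1x_6, x_1x_5 + x_2x_6, x_1x_4 + x_3x_6, x_2x_5 + x_4x_6, x_3x_4 + x_5x_6, x_1x_2 + x_1x_3 + x_4x_5) is a reduction of I. -/
/-- If `J ⊔ (x)` is a reduction of `I` and `x ^ 2 ∈ J * I`, then `J` is a reduction of `I`. -/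
theorem Ideal.exists_pow_succ_eq_mul_of_sup_span_singleton {R : Type*} [CommRing R]
    {I J : Ideal R} {x : R} (hJ : J ≤ I) (hx : x * x ∈ J * I)
    (h : ∃ s : ℕ, 1 ≤ s ∧ I ^ (s + 1) = (J ⊔ Ideal.span {x}) * I ^ s) :
    ∃ s : ℕ, 1 ≤ s ∧ I ^ (s + 1) = J * I ^ s := by
  obtain ⟨s, -, hs⟩ := h
  refine ⟨s + 1, by omega, le_antisymm ?_ ?_⟩
  · have hxx : Ideal.span {x} * Ideal.span {x} ≤ J * I := by
      rw [Ideal.span_singleton_mul_span_singleton, Ideal.span_singleton_le_iff_mem]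
      exact hx
    have hsq : (J ⊔ Ideal.span {x}) * (J ⊔ Ideal.span {x}) ≤
        J * (J ⊔ Ideal.span {x}) ⊔ J * I := by
      rw [Ideal.sup_mul]
      refine sup_le le_sup_left ?_
      rw [Ideal.mul_sup, mul_comm _ J]
      exact sup_le ((Ideal.mul_mono_right le_sup_right).trans le_sup_left)
        (hxx.trans le_sup_right)
    calc I ^ (s + 1 + 1) = (J ⊔ Ideal.span {x}) * (J ⊔ Ideal.span {x}) * I ^ s := by
          rw [pow_succ', hs, mul_assoc, mul_left_comm, ← pow_succ', hs]
      _ ≤ (J * (J ⊔ Ideal.span {x}) ⊔ J * I) * I ^ s := Ideal.mul_mono_left hsq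
      _ = J * I ^ (s + 1) := by
          rw [Ideal.sup_mul, mul_assoc, mul_assoc, ← hs, ← pow_succ', sup_idem]
  · rw [pow_succ' I (s + 1)]
    exact Ideal.mul_mono_left hJ

open MvPolynomial in
/-- A concrete reduction in `K[x₁,…,x₆]` (variables `x_i = X (i-1)`). -/
theorem reduction_binomial_example
    {K : Type*} [Field K]
    (I J : Ideal (MvPolynomial (Fin 6) K))
    (hI : I = Ideal.span
      {X 0 * X 1 + X 0 * X 2, X 0 * X 3, X 0 * X 4, X 0 * X 5,
       X 1 * X 4, X 1 * X 5, X 2 * X 3, X 2 * X 5,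
       X 3 * X 4, X 3 * X 5, X 4 * X 5})
    (hJ : J = Ideal.span
      {X 0 * X 5, X 0 * X 4 + X 1 * X 5, X 0 * X 3 + X 2 * X 5,
       X 1 * X 4 + X 3 * X 5, X 2 * X 3 + X 4 * X 5,
       X 0 * X 1 + X 0 * X 2 + X 3 * X 4}) :
    J ≤ I ∧ ∃ s : ℕ, 1 ≤ s ∧ I ^ (s + 1) = J * I ^ s := by
  have hIgen := (Ideal.span_le (I := I)).1 hI.ge
  have hJgen := (Ideal.span_le (I := J)).1 hJ.ge
  simp only [Set.insert_subset_iff, Set.singleton_subset_iff, SetLike.mem_coe] at hIgen hJgen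
  obtain ⟨ha, hb, hc, hd, he, hf, hg, hh, hi, hj, hk⟩ := hIgen
  obtain ⟨hd', hcf, hbh, hej, hgk, hai⟩ := hJgen
  have hJI : J ≤ I := by
    rw [hJ, Ideal.span_le]
    simp only [Set.insert_subset_iff, Set.singleton_subset_iff, SetLike.mem_coe]
    exact ⟨hd, I.add_mem hc hf, I.add_mem hb hh, I.add_mem he hj, I.add_mem hg hk,
      I.add_mem ha hi⟩
  refine ⟨hJI, ?_⟩
  have sup_le_I {L : Ideal (MvPolynomial (Fin 6) K)} {x : MvPolynomial (Fin 6) K}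
      (hL : L ≤ I) (hx : x ∈ I) : L ⊔ Ideal.span {x} ≤ I :=
    sup_le hL ((Ideal.span_singleton_le_iff_mem _).2 hx)
  have mem_sup_span (L : Ideal (MvPolynomial (Fin 6) K)) (x : MvPolynomial (Fin 6) K) :
      x ∈ L ⊔ Ideal.span {x} :=
    Ideal.mem_sup_right (Ideal.mem_span_singleton_self x)
  have hf2 : (X 1 * X 5) * (X 1 * X 5) ∈ J * I := by
    convert sub_mem (Ideal.mul_mem_mul hcf hf) (Ideal.mul_mem_mul hd' he) using 1
    ring
  refine Ideal.exists_pow_succ_eq_mul_of_sup_span_singleton hJI hf2 ?_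
  have hJ₁ := sup_le_I hJI hf
  have hJJ₁ : J ≤ J ⊔ Ideal.span {X 1 * X 5} := le_sup_left
  have hf' := mem_sup_span J (X 1 * X 5)
  generalize J ⊔ Ideal.span {X 1 * X 5} = J₁ at *
  have hh2 : (X 2 * X 5) * (X 2 * X 5) ∈ J₁ * I := by
    convert sub_mem (Ideal.mul_mem_mul (hJJ₁ hbh) hh) (Ideal.mul_mem_mul (hJJ₁ hd') hg) using 1
    ring
  refine Ideal.exists_pow_succ_eq_mul_of_sup_span_singleton hJ₁ hh2 ?_
  have hJ₂ := sup_le_I hJ₁ hh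
  have hJJ₂ : J ≤ J₁ ⊔ Ideal.span {X 2 * X 5} := hJJ₁.trans le_sup_left
  replace hf' : X 1 * X 5 ∈ J₁ ⊔ Ideal.span {X 2 * X 5} := Ideal.mem_sup_left hf'
  have hh' := mem_sup_span J₁ (X 2 * X 5)
  generalize J₁ ⊔ Ideal.span {X 2 * X 5} = J₂ at *
  have hj2 : (X 3 * X 5) * (X 3 * X 5) ∈ J₂ * I := by
    convert sub_mem (Ideal.mul_mem_mul (hJJ₂ hej) hj) (Ideal.mul_mem_mul hf' hi) using 1
    ring
  have hk2 : (X 4 * X 5) * (X 4 * X 5) ∈ J₂ * I := by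
    convert sub_mem (Ideal.mul_mem_mul (hJJ₂ hgk) hk) (Ideal.mul_mem_mul hh' hi) using 1
    ring
  have hi2 : (X 3 * X 4) * (X 3 * X 4) ∈ J₂ * I := by
    convert add_mem (sub_mem (Ideal.mul_mem_mul (hJJ₂ hai) hi)
      (add_mem (Ideal.mul_mem_mul (hJJ₂ hbh) he) (Ideal.mul_mem_mul (hJJ₂ hcf) hg)))
      (add_mem (Ideal.mul_mem_mul hh' he) (Ideal.mul_mem_mul hf' hg)) using 1
    ring
  refine Ideal.exists_pow_succ_eq_mul_of_sup_span_singleton hJ₂ hj2 ?_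
  have hJ₃ := sup_le_I hJ₂ hj
  have hJ₂₃ : J₂ ≤ J₂ ⊔ Ideal.span {X 3 * X 5} := le_sup_left
  have hj' := mem_sup_span J₂ (X 3 * X 5)
  generalize J₂ ⊔ Ideal.span {X 3 * X 5} = J₃ at *
  refine Ideal.exists_pow_succ_eq_mul_of_sup_span_singleton hJ₃
    (Ideal.mul_mono_left hJ₂₃ hk2) ?_
  have hJ₄ := sup_le_I hJ₃ hk
  have hJ₃₄ : J₃ ≤ J₃ ⊔ Ideal.span {X 4 * X 5} := le_sup_left
  have hk' := mem_sup_span J₃ (X 4 * X 5)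
  generalize J₃ ⊔ Ideal.span {X 4 * X 5} = J₄ at *
  refine Ideal.exists_pow_succ_eq_mul_of_sup_span_singleton hJ₄
    (Ideal.mul_mono_left (hJ₂₃.trans hJ₃₄) hi2) ?_
  have hJ₅ := sup_le_I hJ₄ hi
  have hJ₄₅ : J₄ ≤ J₄ ⊔ Ideal.span {X 3 * X 4} := le_sup_left
  have hi' := mem_sup_span J₄ (X 3 * X 4)
  generalize J₄ ⊔ Ideal.span {X 3 * X 4} = J₅ at *
  have hJ₂₅ : J₂ ≤ J₅ := hJ₂₃.trans (hJ₃₄.trans hJ₄₅)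
  have hJJ₅ : J ≤ J₅ := hJJ₂.trans hJ₂₅
  replace hf' := hJ₂₅ hf'
  replace hh' := hJ₂₅ hh'
  replace hj' := hJ₄₅ (hJ₃₄ hj')
  replace hk' := hJ₄₅ hk'
  have hIJ₅ : I ≤ J₅ := by
    rw [hI, Ideal.span_le]
    simp only [Set.insert_subset_iff, Set.singleton_subset_iff, SetLike.mem_coe]
    exact ⟨(J₅.add_mem_iff_left hi').1 (hJJ₅ hai), (J₅.add_mem_iff_left hh').1 (hJJ₅ hbh),
      (J₅.add_mem_iff_left hf').1 (hJJ₅ hcf), hJJ₅ hd', (J₅.add_mem_iff_left hj').1 (hJJ₅ hej),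
      hf', (J₅.add_mem_iff_left hk').1 (hJJ₅ hgk), hh', hi', hj', hk'⟩
  exact ⟨1, le_rfl, by rw [le_antisymm hJ₅ hIJ₅, pow_succ']⟩
end

section
/- Let R be a commutative Noetherian local ring, let P be a finite subset of R, and let P_0, P_1, ..., P_r be subsets of P with #P_ℓ = c_ℓ and I = (P). Assume: (Ba1) P = P_0 ∪ P_1 ∪ ... ∪ P_r; (Ba2) #P_0 = 1; (Ba3) for each ℓ with 0 < ℓ ≤ r and c_ℓ ≥ 2, there exists an integer n_ℓ with 2 ≤ n_ℓ ≤ c_ℓ such that for any n_ℓ distinct elements p_1, ..., p_{n_ℓ} ∈ P_ℓ there exist an integer ℓ' with 0 ≤ ℓ' < ℓ and elements p' ∈ P_{ℓ'} and b ∈ I^{n_ℓ−1} with p_1 p_2 ⋯ p_{n_ℓ} = p'·b. For ℓ with c_ℓ = 1 set n_ℓ = 2. For each ℓ = 0, 1, ..., r let A^{(ℓ)} = (a^{(ℓ)}_{ij}) be an (n_ℓ − 1) × c_ℓ matrix over R all of whose maximal minors are units in R. Write P_ℓ = {p_1^{(ℓ)}, ..., p_{c_ℓ}^{(ℓ)}}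 and set g_i^{(ℓ)} = Σ_{j=1}^{c_ℓ} a^{(ℓ)}_{ij} p_j^{(ℓ)} for 1 ≤ i ≤ n_ℓ − 1, and let J be the ideal generated by all the g_i^{(ℓ)} for 0 ≤ ℓ ≤ r and 1 ≤ i ≤ n_ℓ − 1. Then J is a reduction of I. -/
open Polynomial in
/-- The element `x t` of the Rees algebra `R[It]` attached to `x ∈ I ^ m`, placed in degree `m`. -/
noncomputable def reesMonomial {R : Type*} [CommRing R] (I : Ideal R) (m : ℕ) (x : R)
    (hx : x ∈ I ^ m) : reesAlgebra I :=
  ⟨monomial m x, reesAlgebra.monomial_mem.mpr hx⟩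

theorem reesMonomial_mul {R : Type*} [CommRing R] (I : Ideal R) (m k : ℕ) (x y : R)
    (hx : x ∈ I ^ m) (hy : y ∈ I ^ k) :
    reesMonomial I m x hx * reesMonomial I k y hy =
      reesMonomial I (m + k) (x * y) (pow_add I m k ▸ Ideal.mul_mem_mul hx hy) :=
  Subtype.ext (Polynomial.monomial_mul_monomial m k x y)

theorem reesMonomial_add {R : Type*} [CommRing R] (I : Ideal R) (m : ℕ) (x y : R)
    (hx : x ∈ I ^ m) (hy : y ∈ I ^ m) :
    reesMonomial I m (x + y) (add_mem hx hy) = reesMonomial I m x hx + reesMonomial I m y hy :=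
  Subtype.ext (map_add (Polynomial.monomial m) x y)

theorem reesMonomial_sum_smul {R ι : Type*} [CommRing R] [Fintype ι] (I : Ideal R) (m : ℕ)
    (a x : ι → R) (hx : ∀ i, x i ∈ I ^ m) (h : ∑ i, a i * x i ∈ I ^ m) :
    reesMonomial I m (∑ i, a i * x i) h = ∑ i, a i • reesMonomial I m (x i) (hx i) := by
  apply Subtype.ext
  simp [reesMonomial, Polynomial.smul_monomial]

theorem reesMonomial_prod {R ι : Type*} [CommRing R] (I : Ideal R) (s : Finset ι)
    (x : ι → R) (hx : ∀ i, x i ∈ I ^ 1) :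
    ((∏ i ∈ s, reesMonomial I 1 (x i) (hx i) : reesAlgebra I) : Polynomial R) =
      Polynomial.monomial s.card (∏ i ∈ s, x i) := by
  classical
  induction s using Finset.induction_on with
  | empty => simp
  | insert a s ha ih =>
    rw [Finset.prod_insert ha, Finset.prod_insert ha, Finset.card_insert_of_notMem ha,
      Subalgebra.coe_mul, ih, add_comm]
    exact Polynomial.monomial_mul_monomial 1 s.card _ _

/-- If all maximal minors of a matrix act invertibly on a domain, then a vector in its kernel
whose products of more than `m` distinct coordinates vanish is zero. -/
theorem eq_zero_of_isUnit_minors_of_prod_eq_zero {R B : Type*} [CommRing R] [CommRing B]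
    [IsDomain B] [Algebra R B] {m c : ℕ} (hmc : m ≤ c) (A : Matrix (Fin m) (Fin c) R)
    (hA : ∀ e : Fin m → Fin c, Function.Injective e → IsUnit (A.submatrix id e).det)
    (v : Fin c → B) (hv : ∀ i, ∑ j, A i j • v j = 0)
    (hprod : ∀ e : Fin (m + 1) → Fin c, Function.Injective e → ∏ k, v (e k) = 0) : v = 0 := by
  classical
  let S : Finset (Fin c) := Finset.univ.filter fun j => v j ≠ 0
  have hS : S.card ≤ m := by
    by_contra! h
    obtain ⟨T, hTS, hT⟩ := Finset.exists_subset_card_eq (Nat.succ_le_of_lt h)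
    obtain ⟨k, -, hk⟩ := Finset.prod_eq_zero_iff.mp
      (hprod (T.orderEmbOfFin hT) (T.orderEmbOfFin hT).injective)
    exact (Finset.mem_filter.mp (hTS (T.orderEmbOfFin_mem hT k))).2 hk
  obtain ⟨T, hST, -, hT⟩ := Finset.exists_subsuperset_card_eq (Finset.subset_univ S) hS
    (by simpa using hmc)
  let e := T.orderEmbOfFin hT
  have hzero : ∀ j ∉ T, v j = 0 := fun j hj => by
    by_contra h
    exact hj (hST (Finset.mem_filter.mpr ⟨Finset.mem_univ j, h⟩))
  have hker : ((A.submatrix id e).map (algebraMap R B)).mulVec (v ∘ e) = 0 := by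
    funext i
    have hsum : ∑ k, A i (e k) • v (e k) = ∑ j ∈ T, A i j • v j := by
      rw [← Finset.image_orderEmbOfFin_univ T hT, Finset.sum_image e.injective.injOn]
    rw [Finset.sum_subset (Finset.subset_univ T) fun j _ hj => by rw [hzero j hj, smul_zero],
      hv i] at hsum
    simpa [Matrix.mulVec, dotProduct, Algebra.smul_def] using hsum
  have hdet : ((A.submatrix id e).map (algebraMap R B)).det ≠ 0 := by
    have h := ((hA e e.injective).map (algebraMap R B)).ne_zero
    rwa [RingHom.map_det] at h
  have he := Matrix.eq_zero_of_mulVec_eq_zero hdet hker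
  funext j
  by_cases hj : j ∈ T
  · obtain ⟨k, rfl⟩ : j ∈ Set.range e := by rwa [Finset.range_orderEmbOfFin]
    exact congrFun he k
  · exact hzero j hj

/-- If every degree-one generator of the Rees algebra `R[It]` lies in the radical of the ideal
generated by `Jt`, then `J` is a reduction of `I`. -/
theorem exists_pow_succ_eq_mul_pow_of_le_radical {R : Type*} [CommRing R] {I J : Ideal R}
    (hJI : J ≤ I) {X : Set R} (hX : X.Finite) (hI : I = Ideal.span X)
    (hrad : ∀ Q : Ideal (reesAlgebra I), Q.IsPrime →
      (∀ y (hy : y ∈ I ^ 1), y ∈ J → reesMonomial I 1 y hy ∈ Q) →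
      ∀ x (hx : x ∈ I ^ 1), x ∈ X → reesMonomial I 1 x hx ∈ Q) :
    ∃ s : ℕ, 1 ≤ s ∧ I ^ (s + 1) = J * I ^ s := by
  have hXI : ∀ x ∈ X, x ∈ I ^ 1 := fun x hx => by
    rw [pow_one, hI]; exact Ideal.subset_span hx
  let K : Ideal (reesAlgebra I) :=
    Ideal.span {f | ∃ y, ∃ hy : y ∈ I ^ 1, y ∈ J ∧ reesMonomial I 1 y hy = f}
  let M : Ideal (reesAlgebra I) :=
    Ideal.span (Set.range fun x : X => reesMonomial I 1 x (hXI x x.2))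
  have hMK : M ≤ K.radical := by
    rw [Ideal.span_le]
    rintro _ ⟨x, rfl⟩
    rw [SetLike.mem_coe, Ideal.radical_eq_sInf, Ideal.mem_sInf]
    rintro Q ⟨hKQ, hQ⟩
    exact hrad Q hQ (fun y hy hyJ => hKQ (Ideal.subset_span ⟨y, hy, hyJ, rfl⟩)) x _ x.2
  have := hX.to_subtype
  have hMfg : M.FG := Submodule.fg_span (Set.finite_range _)
  obtain ⟨N, hN⟩ := Ideal.exists_pow_le_of_le_radical_of_fg hMK hMfg
  have hM1 : ∀ x (hx : x ∈ I ^ 1), reesMonomial I 1 x hx ∈ M := by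
    intro x hx
    have hx' : x ∈ Submodule.span R X := by rw [pow_one, hI] at hx; exact hx
    induction hx' using Submodule.span_induction with
    | mem x h => exact Ideal.subset_span ⟨⟨x, h⟩, rfl⟩
    | zero =>
      convert M.zero_mem
      exact Subtype.ext (map_zero (Polynomial.monomial 1))
    | add x y h₁ h₂ ih₁ ih₂ =>
      have h₁' : x ∈ I ^ 1 := by rw [pow_one, hI]; exact h₁
      have h₂' : y ∈ I ^ 1 := by rw [pow_one, hI]; exact h₂
      rw [reesMonomial_add I 1 x y h₁' h₂']
      exact add_mem (ih₁ h₁') (ih₂ h₂')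
    | smul a x h ih =>
      have h' : x ∈ I ^ 1 := by rw [pow_one, hI]; exact h
      convert M.mul_mem_left (algebraMap R _ a) (ih h')
      exact Subtype.ext (by simp [reesMonomial, Polynomial.C_mul_monomial])
  have hMpow : ∀ k x (hx : x ∈ I ^ k), reesMonomial I k x hx ∈ M ^ k := by
    intro k
    induction k with
    | zero => intro x hx; simp
    | succ k ih =>
      intro x hx
      have hx' : x ∈ I ^ k * I := hx
      induction hx' using Submodule.mul_induction_on' with
      | mem_mul_mem a ha b hb =>
        have hb' : b ∈ I ^ 1 := by rwa [pow_one]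
        rw [pow_succ, ← reesMonomial_mul I k 1 a b ha hb']
        exact Ideal.mul_mem_mul (ih a ha) (hM1 b hb')
      | add a ha b hb iha ihb =>
        rw [reesMonomial_add I (k + 1) a b ha hb]
        exact add_mem (iha ha) (ihb hb)
  have hK : ∀ f ∈ K, (f : Polynomial R).coeff 0 = 0 ∧
      ∀ k, (f : Polynomial R).coeff (k + 1) ∈ J * I ^ k := by
    intro f hf
    induction hf using Submodule.span_induction with
    | mem f h =>
      obtain ⟨y, hy, hyJ, rfl⟩ := h
      refine ⟨by simp [reesMonomial, Polynomial.coeff_monomial], fun k => ?_⟩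
      rcases k with _ | k
      · simpa [reesMonomial] using hyJ
      · simp [reesMonomial, Polynomial.coeff_monomial]
    | zero => simp
    | add f h _ _ ihf ihh =>
      exact ⟨by simp [ihf.1, ihh.1], fun k => by simpa using add_mem (ihf.2 k) (ihh.2 k)⟩
    | smul a f _ ih =>
      refine ⟨by simp [ih.1], fun k => ?_⟩
      rw [smul_eq_mul, Subalgebra.coe_mul, Polynomial.coeff_mul]
      refine Ideal.sum_mem _ fun ⟨i, j⟩ hij => ?_
      rw [Finset.HasAntidiagonal.mem_antidiagonal] at hij
      rcases j with _ | j
      · simp [ih.1]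
      · obtain rfl : k = i + j := by simp only at hij; omega
        have h := Ideal.mul_mem_mul (a.2 i) (ih.2 j)
        rwa [mul_left_comm, ← pow_add] at h
  refine ⟨N + 1, by omega, le_antisymm (fun x hx => ?_) ?_⟩
  · have h := (hK _ (hN (Ideal.pow_le_pow_right (by omega : N ≤ N + 1 + 1)
      (hMpow (N + 1 + 1) x hx)))).2 (N + 1)
    simpa [reesMonomial] using h
  · rw [pow_succ' I (N + 1)]
    exact Ideal.mul_mono_left hJI

/-- Barile (1996) type lemma for reductions, in a Noetherian local ring. -/
theorem barile96_type_lemma_for_reductions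
    {R : Type*} [CommRing R] [IsNoetherianRing R] [IsLocalRing R]
    (r : ℕ) (c : ℕ → ℕ) (p : (ℓ : ℕ) → Fin (c ℓ) → R)
    (hp : ∀ ℓ ≤ r, Function.Injective (p ℓ))
    (I : Ideal R) (hI : I = Ideal.span (⋃ ℓ ≤ r, Set.range (p ℓ)))
    (hBa2 : c 0 = 1)
    (n : ℕ → ℕ)
    (hBa3 : ∀ ℓ, 0 < ℓ → ℓ ≤ r → 2 ≤ c ℓ →
      2 ≤ n ℓ ∧ n ℓ ≤ c ℓ ∧
        ∀ e : Fin (n ℓ) → Fin (c ℓ), Function.Injective e →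
          ∃ ℓ' < ℓ, ∃ j : Fin (c ℓ'), ∃ b ∈ I ^ (n ℓ - 1),
            (∏ k : Fin (n ℓ), p ℓ (e k)) = p ℓ' j * b)
    (hn1 : ∀ ℓ ≤ r, c ℓ = 1 → n ℓ = 2)
    (A : (ℓ : ℕ) → Matrix (Fin (n ℓ - 1)) (Fin (c ℓ)) R)
    (hA : ∀ ℓ ≤ r, ∀ e : Fin (n ℓ - 1) → Fin (c ℓ), Function.Injective e →
      IsUnit (((A ℓ).submatrix id e).det))
    (g : (ℓ : ℕ) → Fin (n ℓ - 1) → R)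
    (hg : ∀ ℓ ≤ r, ∀ i, g ℓ i = ∑ j : Fin (c ℓ), A ℓ i j * p ℓ j)
    (J : Ideal R)
    (hJ : J = Ideal.span (⋃ ℓ ≤ r, Set.range (g ℓ))) :
    J ≤ I ∧ ∃ s : ℕ, 1 ≤ s ∧ I ^ (s + 1) = J * I ^ s := by
  subst hI
  set I := Ideal.span (⋃ ℓ ≤ r, Set.range (p ℓ)) with hI
  have hpI : ∀ ℓ ≤ r, ∀ j, p ℓ j ∈ I := fun ℓ hℓ j =>
    Ideal.subset_span (Set.mem_biUnion (x := ℓ) hℓ ⟨j, rfl⟩)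
  have hgI : ∀ ℓ ≤ r, ∀ i, g ℓ i ∈ I := fun ℓ hℓ i => by
    rw [hg ℓ hℓ]
    exact Ideal.sum_mem _ fun j _ => I.mul_mem_left _ (hpI ℓ hℓ j)
  have hgJ : ∀ ℓ ≤ r, ∀ i, g ℓ i ∈ J := fun ℓ hℓ i => by
    rw [hJ]
    exact Ideal.subset_span (Set.mem_biUnion (x := ℓ) hℓ ⟨i, rfl⟩)
  have hJI : J ≤ I := by
    rw [hJ, Ideal.span_le]
    intro x hx
    obtain ⟨ℓ, hℓ, i, rfl⟩ := Set.mem_iUnion₂.mp hx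
    exact hgI ℓ hℓ i
  refine ⟨hJI, exists_pow_succ_eq_mul_pow_of_le_radical hJI
    ((Set.finite_Iic r).biUnion fun ℓ _ => Set.finite_range (p ℓ)) hI fun Q hQ hJQ => ?_⟩
  have key : ∀ ℓ ≤ r, ∀ j (h : p ℓ j ∈ I ^ 1), reesMonomial I 1 (p ℓ j) h ∈ Q := by
    intro ℓ
    induction ℓ using Nat.strong_induction_on with
    | _ ℓ ih =>
      intro hℓ j _
      have hp1 : ∀ j, p ℓ j ∈ I ^ 1 := fun j => by rw [pow_one]; exact hpI ℓ hℓ j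
      have hn : 1 ≤ n ℓ ∧ n ℓ - 1 ≤ c ℓ := by
        have := j.pos
        by_cases hc : c ℓ = 1
        · have := hn1 ℓ hℓ hc
          omega
        · have hℓ0 : 0 < ℓ := Nat.pos_of_ne_zero fun h => hc (h ▸ hBa2)
          have := hBa3 ℓ hℓ0 hℓ (by omega)
          omega
      have hv := eq_zero_of_isUnit_minors_of_prod_eq_zero hn.2 (A ℓ) (hA ℓ hℓ)
        (fun j => Ideal.Quotient.mkₐ R Q (reesMonomial I 1 (p ℓ j) (hp1 j))) ?_ ?_
      · exact Ideal.Quotient.eq_zero_iff_mem.mp (congrFun hv j)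
      · intro i
        have hgi : ∑ j, A ℓ i j * p ℓ j ∈ I ^ 1 := by
          rw [← hg ℓ hℓ, pow_one]; exact hgI ℓ hℓ i
        have h := hJQ _ hgi (hg ℓ hℓ i ▸ hgJ ℓ hℓ i)
        rw [reesMonomial_sum_smul I 1 (A ℓ i) (p ℓ) hp1] at h
        have h0 : Ideal.Quotient.mkₐ R Q (∑ k, A ℓ i k • reesMonomial I 1 (p ℓ k) (hp1 k)) = 0 :=
          Ideal.Quotient.eq_zero_iff_mem.mpr h
        simpa only [map_sum, map_smul] using h0
      · rw [Nat.sub_add_cancel hn.1]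
        intro e he
        have hcard := Fintype.card_le_of_injective e he
        rw [Fintype.card_fin, Fintype.card_fin] at hcard
        have hc : c ℓ ≠ 1 := fun hc => by have := hn1 ℓ hℓ hc; omega
        have hℓ0 : 0 < ℓ := Nat.pos_of_ne_zero fun h => hc (h ▸ hBa2)
        have hj := j.pos
        obtain ⟨-, -, h⟩ := hBa3 ℓ hℓ0 hℓ (by omega)
        obtain ⟨ℓ', hℓ', j', b, hb, hprod⟩ := h e he
        have hp' : p ℓ' j' ∈ I ^ 1 := by rw [pow_one]; exact hpI ℓ' (by omega) j'
        rw [← map_prod]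
        refine Ideal.Quotient.eq_zero_iff_mem.mpr ?_
        convert Q.mul_mem_right (reesMonomial I (n ℓ - 1) b hb) (ih ℓ' hℓ' (by omega) j' hp')
        apply Subtype.ext
        rw [reesMonomial_prod I Finset.univ (fun k => p ℓ (e k)) fun k => hp1 (e k), hprod,
          reesMonomial_mul, Finset.card_fin]
        simp only [reesMonomial]
        rw [Nat.add_sub_cancel' hn.1]
  intro x hx hxP
  obtain ⟨ℓ, hℓ, j, rfl⟩ := Set.mem_iUnion₂.mp hxP
  exact key ℓ hℓ j hx
end

section
/- Let r ≥ 2 be an integer, let K be a field, and let R = K[x_1, x_2, ..., x_{2r}] be a polynomial ring over K. Let I = (x_1x_2, x_2x_3, ..., x_{2r−1}x_{2r}, x_{2r}x_1) be the edge ideal of the cycle on 2r vertices. Then the ideal J generated by the 2r − 1 elements x_1x_2, x_3x_4, ..., x_{2r−1}x_{2r} together with x_2x_3 + x_{2r}x_1, x_4x_5 + x_{2r}x_1, ..., x_{2r−2}x_{2r−1} + x_{2r}x_1 is a reduction of I. -/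
/-- If `I` is generated by `J` and one further element `b`, then `I ^ (n + 1)` is generated by
`J * I ^ n` and `b ^ (n + 1)`. -/
theorem Ideal.pow_succ_le_mul_pow_sup_span_singleton {R : Type*} [CommRing R] {I J : Ideal R}
    {b : R} (hb : b ∈ I) (hI : I ≤ J ⊔ Ideal.span {b}) (n : ℕ) :
    I ^ (n + 1) ≤ J * I ^ n ⊔ Ideal.span {b ^ (n + 1)} := by
  induction n with
  | zero => simpa using hI
  | succ n ih =>
    have hspan : Ideal.span {b ^ (n + 1)} ≤ I ^ (n + 1) := by
      rw [Ideal.span_singleton_le_iff_mem]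
      exact Ideal.pow_mem_pow hb _
    calc I ^ (n + 1 + 1) = I ^ (n + 1) * I := pow_succ _ _
      _ ≤ (J * I ^ n ⊔ Ideal.span {b ^ (n + 1)}) * I := Ideal.mul_mono_left ih
      _ = J * I ^ (n + 1) ⊔ Ideal.span {b ^ (n + 1)} * I := by
        rw [Ideal.sup_mul, mul_assoc, ← pow_succ]
      _ ≤ J * I ^ (n + 1) ⊔ Ideal.span {b ^ (n + 1)} * (J ⊔ Ideal.span {b}) :=
        sup_le_sup_left (Ideal.mul_mono_right hI) _
      _ ≤ J * I ^ (n + 1) ⊔ Ideal.span {b ^ (n + 1 + 1)} := by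
        rw [Ideal.mul_sup, Ideal.span_singleton_mul_span_singleton, ← pow_succ]
        refine sup_le le_sup_left (sup_le_sup_right ?_ _)
        rw [mul_comm]
        exact Ideal.mul_mono_right hspan

/-- If each `f k` is congruent to `-b` modulo `J`, then the product of `b` with `n` of the `f k`
is congruent to `± b ^ (n + 1)` modulo `J * I ^ n`. -/
theorem Ideal.mul_prod_sub_pow_mem_mul_pow {R : Type*} [CommRing R] {I J : Ideal R} {b : R}
    (hb : b ∈ I) (f : ℕ → R) (n : ℕ) (hfI : ∀ k < n, f k ∈ I) (hfJ : ∀ k < n, f k + b ∈ J) :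
    b * ∏ k ∈ Finset.range n, f k - (-1) ^ n * b ^ (n + 1) ∈ J * I ^ n := by
  induction n with
  | zero => simp
  | succ n ih =>
    have ih := ih (fun k hk => hfI k (by omega)) (fun k hk => hfJ k (by omega))
    have hprod : b * ∏ k ∈ Finset.range n, f k ∈ I ^ (n + 1) := by
      rw [pow_succ']
      refine Ideal.mul_mem_mul hb ?_
      have := Ideal.prod_mem_prod (s := Finset.range n) (I := fun _ => I) (x := f)
        fun k hk => hfI k (by have := Finset.mem_range.mp hk; omega)
      simpa using this
    have h₁ := Ideal.mul_mem_mul (hfJ n (by omega)) hprod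
    have h₂ := Ideal.mul_mem_mul ih hb
    rw [mul_assoc, ← pow_succ] at h₂
    convert sub_mem h₁ h₂ using 1
    rw [Finset.prod_range_succ]
    ring

/-- Both perfect matchings of an even cycle have the same product of vertices. -/
theorem prod_even_edges_eq_prod_odd_edges {R : Type*} [CommMonoid R] (y : ℕ → R) (n : ℕ) :
    ∏ k ∈ Finset.range (n + 1), y (2 * k) * y (2 * k + 1) =
      y (2 * n + 1) * y 0 * ∏ k ∈ Finset.range n, y (2 * k + 1) * y (2 * k + 2) := by
  induction n with
  | zero => simp [mul_comm]
  | succ n ih =>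
    rw [Finset.prod_range_succ, ih, Finset.prod_range_succ, show 2 * (n + 1) = 2 * n + 2 by ring]
    ac_rfl


open MvPolynomial in
/-- A minimal reduction of the edge ideal of the `2r`-cycle.  The vertices are
indexed by `ZMod (2r)` (with `x_i = X (i-1)`, so `x₁x₂ = X 0 * X 1` and
`x_{2r} x_1 = X (2r-1) * X 0`). -/
theorem reduction_edge_ideal_even_cycle
    {K : Type*} [Field K] (r : ℕ) (hr : 2 ≤ r)
    (I : Ideal (MvPolynomial (ZMod (2 * r)) K))
    (hI : I = Ideal.span (Set.range fun i : ZMod (2 * r) =>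
      (X i : MvPolynomial (ZMod (2 * r)) K) * X (i + 1)))
    (J : Ideal (MvPolynomial (ZMod (2 * r)) K))
    (hJ : J = Ideal.span
      ((Set.range fun k : Fin r =>
        (X ((2 * (k : ℕ) : ℕ) : ZMod (2 * r)) : MvPolynomial (ZMod (2 * r)) K) *
          X ((2 * (k : ℕ) + 1 : ℕ) : ZMod (2 * r))) ∪
       (Set.range fun k : Fin (r - 1) =>
        (X ((2 * (k : ℕ) + 1 : ℕ) : ZMod (2 * r)) : MvPolynomial (ZMod (2 * r)) K) *
          X ((2 * (k : ℕ) + 2 : ℕ) : ZMod (2 * r)) +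
          X ((2 * r - 1 : ℕ) : ZMod (2 * r)) * X ((0 : ℕ) : ZMod (2 * r))))) :
    J ≤ I ∧ ∃ s : ℕ, 1 ≤ s ∧ I ^ (s + 1) = J * I ^ s := by
  obtain ⟨n, rfl⟩ : ∃ n, r = n + 1 := ⟨r - 1, by omega⟩
  let y : ℕ → MvPolynomial (ZMod (2 * (n + 1))) K := fun m => X (m : ZMod (2 * (n + 1)))
  have hyI (m : ℕ) : y m * y (m + 1) ∈ I := by
    rw [hI]
    exact Ideal.subset_span ⟨m, by simp [y]⟩
  have hy0 : y (2 * n + 1 + 1) = y 0 := by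
    have h : ((2 * n + 1 + 1 : ℕ) : ZMod (2 * (n + 1))) = ((0 : ℕ) : ZMod (2 * (n + 1))) := by
      rw [show 2 * n + 1 + 1 = 2 * (n + 1) by ring, ZMod.natCast_self, Nat.cast_zero]
    simp only [y, h]
  set b := y (2 * n + 1) * y 0 with hb
  have hbI : b ∈ I := by
    rw [hb, ← hy0]
    exact hyI _
  have heven (k : ℕ) (hk : k < n + 1) : y (2 * k) * y (2 * k + 1) ∈ J := by
    rw [hJ]
    exact Ideal.subset_span (Or.inl ⟨⟨k, hk⟩, rfl⟩)
  have hodd (k : ℕ) (hk : k < n) : y (2 * k + 1) * y (2 * k + 2) + b ∈ J := by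
    rw [hJ]
    exact Ideal.subset_span (Or.inr ⟨⟨k, hk⟩, rfl⟩)
  have hJI : J ≤ I := by
    rw [hJ, Ideal.span_le]
    rintro _ (⟨k, rfl⟩ | ⟨k, rfl⟩)
    · exact hyI _
    · exact add_mem (hyI _) hbI
  have hIJ : I ≤ J ⊔ Ideal.span {b} := by
    have hbmem : b ∈ J ⊔ Ideal.span {b} :=
      Ideal.mem_sup_right (Ideal.mem_span_singleton_self b)
    rw [hI, Ideal.span_le]
    rintro _ ⟨i, rfl⟩
    have hi : (X i * X (i + 1) : MvPolynomial (ZMod (2 * (n + 1))) K) =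
        y i.val * y (i.val + 1) := by
      simp [y]
    have hlt := ZMod.val_lt i
    simp only [SetLike.mem_coe, hi]
    generalize i.val = m at hlt
    obtain ⟨k, rfl | rfl⟩ := m.even_or_odd'
    · exact Ideal.mem_sup_left (heven k (by omega))
    · obtain hk | rfl : k < n ∨ k = n := by omega
      · simpa using sub_mem (Ideal.mem_sup_left (hodd k hk)) hbmem
      · rwa [hy0]
  have hbpow : b ^ (n + 1) ∈ J * I ^ n := by
    have hdiff := Ideal.mul_prod_sub_pow_mem_mul_pow hbI
      (fun k => y (2 * k + 1) * y (2 * k + 2)) n (fun k _ => hyI _) hodd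
    have hprod : ∏ k ∈ Finset.range (n + 1), y (2 * k) * y (2 * k + 1) ∈ J * I ^ n := by
      rw [Finset.prod_range_succ, mul_comm (Finset.prod _ _)]
      refine Ideal.mul_mem_mul (heven n n.lt_succ_self) ?_
      simpa using Ideal.prod_mem_prod (s := Finset.range n) (I := fun _ => I)
        (x := fun k => y (2 * k) * y (2 * k + 1)) fun k _ => hyI _
    rw [prod_even_edges_eq_prod_odd_edges] at hprod
    have h := Ideal.mul_mem_left _ ((-1) ^ n) (sub_mem hprod hdiff)
    rwa [sub_sub_cancel, ← mul_assoc, ← mul_pow, neg_one_mul, neg_neg, one_pow, one_mul] at h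
  refine ⟨hJI, n, by omega, le_antisymm ?_ ?_⟩
  · refine (Ideal.pow_succ_le_mul_pow_sup_span_singleton hbI hIJ n).trans (sup_le le_rfl ?_)
    rwa [Ideal.span_singleton_le_iff_mem]
  · rw [pow_succ']
    exact Ideal.mul_mono_left hJI
end

section
/- Let R = K[x_1, x_2, x_3, x_4, x_5] be a polynomial ring over a field K, and let I be the edge ideal of the complete graph K_5, i.e., the ideal generated by all x_i x_j with 1 ≤ i < j ≤ 5. Let I_2 = (x_1x_2, x_2x_3, x_4x_5, x_3x_4, x_1x_5), and set g_0 = x_1x_2, g_1 = x_2x_3 + x_4x_5, g_2 = x_3x_4 + x_1x_5. Then I_2³ ⊆ (g_0, g_1, g_2)·I². -/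
/-- If `G` and `B` are contained in `I`, then `(G + B)³ ⊆ G I² + B³`. -/
theorem Ideal.sup_pow_three_le {R : Type*} [CommSemiring R] {G B I : Ideal R}
    (hG : G ≤ I) (hB : B ≤ I) : (G ⊔ B) ^ 3 ≤ G * I ^ 2 ⊔ B ^ 3 := by
  have h : (G + B) ^ 3 = G * ((G + B) ^ 2 + (G + B) * B + B ^ 2) + B ^ 3 := by ring
  have hGB : G + B ≤ I := sup_le hG hB
  have hI : (G + B) ^ 2 + (G + B) * B + B ^ 2 ≤ I ^ 2 := by
    refine sup_le (sup_le (Ideal.pow_right_mono hGB 2) ?_) (Ideal.pow_right_mono hB 2)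
    rw [pow_two]
    exact Ideal.mul_mono hGB hB
  rw [← Submodule.add_eq_sup, h, ← Submodule.add_eq_sup]
  exact sup_le_sup_right (Ideal.mul_mono_right hI) _

open MvPolynomial in
/-- For the edge ideal `I` of the complete graph `K₅` (variables
`x_i = X (i-1)`), with `I₂ = (x₁x₂, x₂x₃, x₄x₅, x₃x₄, x₁x₅)` and the elements
`g₀ = x₁x₂`, `g₁ = x₂x₃ + x₄x₅`, `g₂ = x₃x₄ + x₁x₅`, one has
`I₂³ ⊆ (g₀, g₁, g₂)·I²`. -/
theorem cube_inclusion_K5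
    {K : Type*} [Field K]
    (I I₂ : Ideal (MvPolynomial (Fin 5) K))
    (hI : I = Ideal.span
      {X 0 * X 1, X 0 * X 2, X 0 * X 3, X 0 * X 4, X 1 * X 2,
       X 1 * X 3, X 1 * X 4, X 2 * X 3, X 2 * X 4, X 3 * X 4})
    (hI₂ : I₂ = Ideal.span {X 0 * X 1, X 1 * X 2, X 3 * X 4, X 2 * X 3, X 0 * X 4})
    (g₀ g₁ g₂ : MvPolynomial (Fin 5) K)
    (hg₀ : g₀ = X 0 * X 1)
    (hg₁ : g₁ = X 1 * X 2 + X 3 * X 4)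
    (hg₂ : g₂ = X 2 * X 3 + X 0 * X 4) :
    I₂ ^ 3 ≤ Ideal.span {g₀, g₁, g₂} * I ^ 2 := by
  have mem_J {g u v : MvPolynomial (Fin 5) K} (hg : g ∈ Ideal.span {g₀, g₁, g₂})
      (hu : u ∈ I) (hv : v ∈ I) : g * (u * v) ∈ Ideal.span {g₀, g₁, g₂} * I ^ 2 :=
    Ideal.mul_mem_mul hg (pow_two I ▸ Ideal.mul_mem_mul hu hv)
  have h₀ : g₀ ∈ Ideal.span {g₀, g₁, g₂} := Ideal.subset_span (by simp)
  have h₁ : g₁ ∈ Ideal.span {g₀, g₁, g₂} := Ideal.subset_span (by simp)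
  have h₂ : g₂ ∈ Ideal.span {g₀, g₁, g₂} := Ideal.subset_span (by simp)
  have h01 : X 0 * X 1 ∈ I := hI ▸ Ideal.subset_span (by simp)
  have h02 : X 0 * X 2 ∈ I := hI ▸ Ideal.subset_span (by simp)
  have h04 : X 0 * X 4 ∈ I := hI ▸ Ideal.subset_span (by simp)
  have h12 : X 1 * X 2 ∈ I := hI ▸ Ideal.subset_span (by simp)
  have h14 : X 1 * X 4 ∈ I := hI ▸ Ideal.subset_span (by simp)
  have h23 : X 2 * X 3 ∈ I := hI ▸ Ideal.subset_span (by simp)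
  have h24 : X 2 * X 4 ∈ I := hI ▸ Ideal.subset_span (by simp)
  have h34 : X 3 * X 4 ∈ I := hI ▸ Ideal.subset_span (by simp)
  have hG : Ideal.span {g₀, g₁, g₂} ≤ I := by
    rw [Ideal.span_le]
    rintro _ (rfl | rfl | rfl)
    · exact hg₀ ▸ h01
    · exact hg₁ ▸ I.add_mem h12 h34
    · exact hg₂ ▸ I.add_mem h23 h04
  have hB : Ideal.span {X 1 * X 2, X 2 * X 3} ≤ I := by
    rw [Ideal.span_le]
    rintro _ (rfl | rfl)
    exacts [h12, h23]
  have hle : I₂ ≤ Ideal.span {g₀, g₁, g₂} ⊔ Ideal.span {X 1 * X 2, X 2 * X 3} := by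
    have hb : X 1 * X 2 ∈ Ideal.span {g₀, g₁, g₂} ⊔ Ideal.span {X 1 * X 2, X 2 * X 3} :=
      Ideal.mem_sup_right (Ideal.subset_span (by simp))
    have hd : X 2 * X 3 ∈ Ideal.span {g₀, g₁, g₂} ⊔ Ideal.span {X 1 * X 2, X 2 * X 3} :=
      Ideal.mem_sup_right (Ideal.subset_span (by simp))
    rw [hI₂, Ideal.span_le]
    rintro _ (rfl | rfl | rfl | rfl | rfl)
    · exact hg₀ ▸ Ideal.mem_sup_left h₀
    · exact hb
    · exact (Ideal.add_mem_iff_right _ hb).1 (hg₁ ▸ Ideal.mem_sup_left h₁)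
    · exact hd
    · exact (Ideal.add_mem_iff_right _ hd).1 (hg₂ ▸ Ideal.mem_sup_left h₂)
  refine (Ideal.pow_right_mono hle 3).trans
    ((Ideal.sup_pow_three_le hG hB).trans (sup_le le_rfl ?_))
  have hbbb : (X 1 * X 2) ^ 3 ∈ Ideal.span {g₀, g₁, g₂} * I ^ 2 := by
    convert add_mem (sub_mem (mem_J h₁ h12 h12) (mem_J h₂ h12 h14)) (mem_J h₀ h24 h14) using 1
    rw [hg₀, hg₁, hg₂]
    ring
  have hbbd : (X 1 * X 2) ^ 2 * (X 2 * X 3) ∈ Ideal.span {g₀, g₁, g₂} * I ^ 2 := by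
    convert sub_mem (mem_J h₂ h12 h12) (mem_J h₀ h12 h24) using 1
    rw [hg₀, hg₂]
    ring
  have hbdd : (X 1 * X 2) * (X 2 * X 3) ^ 2 ∈ Ideal.span {g₀, g₁, g₂} * I ^ 2 := by
    convert sub_mem (mem_J h₂ h12 h23) (mem_J h₀ h23 h24) using 1
    rw [hg₀, hg₂]
    ring
  have hddd : (X 2 * X 3) ^ 3 ∈ Ideal.span {g₀, g₁, g₂} * I ^ 2 := by
    convert sub_mem (add_mem (sub_mem (mem_J h₂ h23 h23) (mem_J h₂ h23 h04))
      (mem_J h₁ h02 h04)) (mem_J h₀ h24 h02) using 1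
    rw [hg₀, hg₁, hg₂]
    ring
  rw [pow_succ, pow_two, Ideal.span_mul_span', Ideal.span_mul_span', Ideal.span_le]
  rintro _ ⟨_, ⟨_, rfl | rfl, _, rfl | rfl, rfl⟩, _, rfl | rfl, rfl⟩
  all_goals rw [SetLike.mem_coe]
  · convert hbbb using 1; ring
  · convert hbbd using 1; ring
  · convert hbbd using 1; ring
  · convert hbdd using 1; ring
  · convert hbbd using 1; ring
  · convert hbdd using 1; ring
  · convert hbdd using 1; ring
  · convert hddd using 1; ring
end
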